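/- Let G ~ N_d(0,K) be independent of A, assume E[‖A‖_HS^8] < ∞ and ℙ(E) > 0. Then ℙ(E)·( (1/2)·E[((∂g̃/∂t)(A,0,G))²] − (1/6)·E[((∂g̃/∂t)(A,0,G))³] + (1/2)·E[(∂²g̃/∂t²)(A,0,G)·(∂g̃/∂t)(A,0,G)] ) ≤ (√3/(12√2))·(2√6+3√2+2+√d)·‖K^{-1}‖_HS²·( ‖E[A]−K‖_HS² + (8/λ(K)²)·E[‖A−K‖_HS²]² + (32/λ(K)⁴)·‖K‖_HS²·E[‖A−K‖_HS⁴] ) + (√3/8)·‖K^{-1}‖_HS⁴·E[‖A−K‖_HS⁴]. -/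

import Mathlib

open MeasureTheory ProbabilityTheory Matrix

noncomputable section

/-- Euclidean norm on `Fin d → ℝ`. -/
def euclNorm {d : ℕ} (x : Fin d → ℝ) : ℝ := Real.sqrt (∑ i, x i ^ 2)

/-- Hilbert–Schmidt norm of a matrix. -/
def hsNorm {d : ℕ} (M : Matrix (Fin d) (Fin d) ℝ) : ℝ := Real.sqrt (∑ i, ∑ j, M i j ^ 2)

/-- Operator norm of a matrix (w.r.t. the Euclidean norm). -/
def opNorm {d : ℕ} (M : Matrix (Fin d) (Fin d) ℝ) : ℝ :=
  sSup {r : ℝ | ∃ x : Fin d → ℝ, euclNorm x = 1 ∧ r = euclNorm (M.mulVec x)}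

/-- Smallest eigenvalue of a symmetric matrix (as the infimum of the Rayleigh quotient). -/
def lambdaMin {d : ℕ} (M : Matrix (Fin d) (Fin d) ℝ) : ℝ :=
  sInf {r : ℝ | ∃ x : Fin d → ℝ, euclNorm x = 1 ∧ r = x ⬝ᵥ M.mulVec x}

/-- Density of the centered Gaussian law `N_d(0, M)` on `ℝ^d`. -/
def gaussDensity {d : ℕ} (M : Matrix (Fin d) (Fin d) ℝ) (x : Fin d → ℝ) : ℝ :=
  (Real.sqrt ((2 * Real.pi) ^ d * M.det))⁻¹ * Real.exp (-(1/2) * (x ⬝ᵥ M⁻¹.mulVec x))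

/-- The centered Gaussian law `N_d(0, M)` on `ℝ^d` (for `M` positive definite). -/
def gaussLaw {d : ℕ} (M : Matrix (Fin d) (Fin d) ℝ) : Measure (Fin d → ℝ) :=
  volume.withDensity fun x => ENNReal.ofReal (gaussDensity M x)

/-- Relative entropy (Kullback–Leibler divergence) of `μ` with respect to `ν`. -/
def relEnt {E : Type*} [MeasurableSpace E] (μ ν : Measure E) : ℝ :=
  ∫ x, Real.log ((μ.rnDeriv ν x).toReal) ∂μ

/-- `F` is a centered, integrable random vector which is conditionally Gaussian with respect to
the σ-field `𝓕`, with conditional covariance matrix `A`. -/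
def CondGaussian {Ω : Type*} [MeasurableSpace Ω] (P : Measure Ω) {d : ℕ}
    (F : Ω → Fin d → ℝ) (𝓕 : MeasurableSpace Ω)
    (A : Ω → Matrix (Fin d) (Fin d) ℝ) : Prop :=
  Integrable F P ∧ (∫ ω, F ω ∂P) = 0 ∧
  (∀ ω, (A ω).PosSemidef) ∧
  Measurable[𝓕] (fun ω i j => A ω i j) ∧
  ∀ y : Fin d → ℝ,
    P[(fun ω => Complex.exp (Complex.I * ((y ⬝ᵥ F ω : ℝ) : ℂ))) | 𝓕] =ᵐ[P]
      fun ω => ((Real.exp (-(1/2) * (y ⬝ᵥ (A ω).mulVec y)) : ℝ) : ℂ)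

/-- The dimensional constant `2√6 + 3√2 + 2 + √d`. -/
def Cfac (d : ℕ) : ℝ := 2 * Real.sqrt 6 + 3 * Real.sqrt 2 + 2 + Real.sqrt d

/-- `max{ |log(2^d det K/(2‖K‖_op + λ(K))^d)| , log(2^d det K/λ(K)^d) }`. -/
def maxLog {d : ℕ} (K : Matrix (Fin d) (Fin d) ℝ) : ℝ :=
  max |Real.log ((2 ^ d * K.det) / ((2 * opNorm K + lambdaMin K) ^ d))|
      (Real.log ((2 ^ d * K.det) / (lambdaMin K ^ d)))


/-- The event `E = {‖A − K‖_op ≤ λ(K)/2}`. -/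
def EvSet {Ω : Type*} {d : ℕ} (A : Ω → Matrix (Fin d) (Fin d) ℝ)
    (K : Matrix (Fin d) (Fin d) ℝ) : Set Ω :=
  {ω | opNorm (A ω - K) ≤ lambdaMin K / 2}


/-- The interpolating matrix `Γ_t = tA + (1−t)K`. -/
def Gam {d : ℕ} (A K : Matrix (Fin d) (Fin d) ℝ) (t : ℝ) : Matrix (Fin d) (Fin d) ℝ :=
  t • A + (1 - t) • K

/-- The interpolating density ratio `g(A,t,x) = φ_{Γ_t}(x)/φ_K(x)`. -/
def gfun {d : ℕ} (A K : Matrix (Fin d) (Fin d) ℝ) (t : ℝ) (x : Fin d → ℝ) : ℝ :=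
  gaussDensity (Gam A K t) x / gaussDensity K x

/-- `h_k(A,t,x) = (∂^k g/∂t^k)(A,t,x) / g(A,t,x)`. -/
def hfun {d : ℕ} (k : ℕ) (A K : Matrix (Fin d) (Fin d) ℝ) (t : ℝ) (x : Fin d → ℝ) : ℝ :=
  iteratedDeriv k (fun s => gfun A K s x) t / gfun A K t x

/-- `g̃(A,t,x) = E[φ_{Γ_t}(x) 1_E] / (P(E) φ_K(x))`. -/
def gtilde {Ω : Type*} [MeasurableSpace Ω] (P : Measure Ω) {d : ℕ}
    (A : Ω → Matrix (Fin d) (Fin d) ℝ) (K : Matrix (Fin d) (Fin d) ℝ)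
    (t : ℝ) (x : Fin d → ℝ) : ℝ :=
  (∫ ω in EvSet A K, gaussDensity (Gam (A ω) K t) x ∂P) /
    ((P (EvSet A K)).toReal * gaussDensity K x)

end


section LinAlg
variable {d : ℕ}

lemma psd_trace_mul_nonneg {M N : Matrix (Fin d) (Fin d) ℝ} (hM : M.PosSemidef)
    (hN : N.PosSemidef) : 0 ≤ (M * N).trace := by
  open scoped MatrixOrder in
  have h1 : CFC.sqrt M * CFC.sqrt M = M := CFC.sqrt_mul_sqrt_self M hM.nonneg
  open scoped MatrixOrder in
  have h2 : (CFC.sqrt M).PosSemidef := (CFC.sqrt_nonneg M).posSemidef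
  open scoped MatrixOrder in
  have h3 : (CFC.sqrt M * N * (CFC.sqrt M)ᴴ).trace = (M * N).trace := by
    rw [h2.1.eq, Matrix.trace_mul_comm, ← Matrix.mul_assoc, h1]
  rw [← h3]
  exact (hN.mul_mul_conjTranspose_same _).trace_nonneg

lemma euclNorm_nonneg (x : Fin d → ℝ) : 0 ≤ euclNorm x := Real.sqrt_nonneg _
lemma euclNorm_sq (x : Fin d → ℝ) : euclNorm x ^ 2 = ∑ i, x i ^ 2 :=
  Real.sq_sqrt (Finset.sum_nonneg fun _ _ => sq_nonneg _)
lemma hsNorm_nonneg (M : Matrix (Fin d) (Fin d) ℝ) : 0 ≤ hsNorm M := Real.sqrt_nonneg _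
lemma hsNorm_sq (M : Matrix (Fin d) (Fin d) ℝ) : hsNorm M ^ 2 = ∑ i, ∑ j, M i j ^ 2 :=
  Real.sq_sqrt (Finset.sum_nonneg fun _ _ => Finset.sum_nonneg fun _ _ => sq_nonneg _)

lemma euclNorm_smul (c : ℝ) (x : Fin d → ℝ) : euclNorm (c • x) = |c| * euclNorm x := by
  have : ∑ i, (c • x) i ^ 2 = c ^ 2 * ∑ i, x i ^ 2 := by
    simp [Finset.mul_sum, mul_pow]
  unfold euclNorm
  rw [this, Real.sqrt_mul (sq_nonneg c), Real.sqrt_sq_eq_abs]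

lemma euclNorm_eq_zero {x : Fin d → ℝ} (h : euclNorm x = 0) : x = 0 := by
  have h2 := euclNorm_sq x
  rw [h] at h2
  have := (Finset.sum_eq_zero_iff_of_nonneg (fun i _ => sq_nonneg (x i))).1 (by linarith : ∑ i, x i ^ 2 = 0)
  funext i
  simpa using this i (Finset.mem_univ i)

lemma continuous_euclNorm : Continuous (euclNorm : (Fin d → ℝ) → ℝ) := by
  unfold euclNorm; fun_prop

lemma euclNorm_mulVec_le (M : Matrix (Fin d) (Fin d) ℝ) (x : Fin d → ℝ) :
    euclNorm (M *ᵥ x) ≤ hsNorm M * euclNorm x := by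
  refine le_of_sq_le_sq ?_ (mul_nonneg (hsNorm_nonneg _) (euclNorm_nonneg _))
  rw [mul_pow, euclNorm_sq, hsNorm_sq, euclNorm_sq, Finset.sum_mul]
  apply Finset.sum_le_sum
  intro i _
  exact Finset.sum_mul_sq_le_sq_mul_sq Finset.univ (M i) x

lemma abs_dot_le (x y : Fin d → ℝ) : |x ⬝ᵥ y| ≤ euclNorm x * euclNorm y := by
  apply abs_le_of_sq_le_sq _ (mul_nonneg (euclNorm_nonneg _) (euclNorm_nonneg _))
  rw [mul_pow, euclNorm_sq, euclNorm_sq]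
  exact Finset.sum_mul_sq_le_sq_mul_sq _ _ _

lemma exists_unit (x : Fin d → ℝ) (hx : x ≠ 0) :
    ∃ y, euclNorm y = 1 ∧ x = euclNorm x • y := by
  have h : euclNorm x ≠ 0 := fun h => hx (euclNorm_eq_zero h)
  refine ⟨(euclNorm x)⁻¹ • x, ?_, ?_⟩
  · rw [euclNorm_smul, abs_of_nonneg (inv_nonneg.2 (euclNorm_nonneg x)), inv_mul_cancel₀ h]
  · rw [smul_smul, mul_inv_cancel₀ h, one_smul]

lemma opNorm_bdd (M : Matrix (Fin d) (Fin d) ℝ) :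
    BddAbove {r : ℝ | ∃ x : Fin d → ℝ, euclNorm x = 1 ∧ r = euclNorm (M.mulVec x)} := by
  refine ⟨hsNorm M, ?_⟩
  rintro r ⟨x, hx, rfl⟩
  simpa [hx] using euclNorm_mulVec_le M x

lemma unit_single (i : Fin d) : euclNorm (Pi.single i (1:ℝ)) = 1 := by
  unfold euclNorm
  have : ∑ j, (Pi.single i (1:ℝ) : Fin d → ℝ) j ^ 2 = 1 := by
    rw [Finset.sum_eq_single i] <;> simp +contextual [Pi.single_apply]
  rw [this, Real.sqrt_one]

lemma opNorm_le_iff (hd : 1 ≤ d) (M : Matrix (Fin d) (Fin d) ℝ) (c : ℝ) :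
    opNorm M ≤ c ↔ ∀ x : Fin d → ℝ, euclNorm x = 1 → euclNorm (M *ᵥ x) ≤ c := by
  constructor
  · intro h x hx
    exact (le_csSup (opNorm_bdd M) ⟨x, hx, rfl⟩).trans h
  · intro h
    apply csSup_le
    · exact ⟨_, Pi.single ⟨0, hd⟩ 1, unit_single _, rfl⟩
    · rintro r ⟨x, hx, rfl⟩
      exact h x hx

lemma opNorm_le_hsNorm (hd : 1 ≤ d) (M : Matrix (Fin d) (Fin d) ℝ) : opNorm M ≤ hsNorm M := by
  rw [opNorm_le_iff hd]
  intro x hx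
  simpa [hx] using euclNorm_mulVec_le M x

lemma isClosed_opNorm_le (hd : 1 ≤ d) (c : ℝ) :
    IsClosed {M : Matrix (Fin d) (Fin d) ℝ | opNorm M ≤ c} := by
  simp only [opNorm_le_iff hd, Set.ofPred_forall]
  refine isClosed_iInter fun x => isClosed_iInter fun hx => ?_
  refine isClosed_le (continuous_euclNorm.comp ?_) continuous_const
  fun_prop

lemma quad_le {M : Matrix (Fin d) (Fin d) ℝ} (hd : 1 ≤ d) {c : ℝ} (h : opNorm M ≤ c)
    (x : Fin d → ℝ) : |x ⬝ᵥ M *ᵥ x| ≤ c * ∑ i, x i ^ 2 := by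
  rw [opNorm_le_iff hd] at h
  by_cases hx : x = 0
  · simp [hx]
  obtain ⟨y, hy, hxy⟩ := exists_unit x hx
  have h1 := abs_dot_le x (M *ᵥ x)
  have h2 : euclNorm (M *ᵥ x) = euclNorm x * euclNorm (M *ᵥ y) := by
    conv_lhs => rw [hxy]
    rw [Matrix.mulVec_smul, euclNorm_smul, abs_of_nonneg (euclNorm_nonneg x)]
  rw [← euclNorm_sq]
  rw [h2] at h1
  nlinarith [h y hy, sq_nonneg (euclNorm x)]

lemma entry_le {M : Matrix (Fin d) (Fin d) ℝ} (hd : 1 ≤ d) {c : ℝ} (h : opNorm M ≤ c)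
    (i j : Fin d) : |M i j| ≤ c := by
  rw [opNorm_le_iff hd] at h
  refine le_trans ?_ (h (Pi.single j 1) (unit_single j))
  rw [← Real.sqrt_sq_eq_abs]
  apply Real.sqrt_le_sqrt
  have := Finset.single_le_sum (f := fun i => (M *ᵥ Pi.single j 1) i ^ 2) (fun i _ => sq_nonneg _) (Finset.mem_univ i)
  simpa using this

lemma posDef_quad_pos {M : Matrix (Fin d) (Fin d) ℝ} (hM : M.PosDef) {x : Fin d → ℝ} (hx : x ≠ 0) :
    0 < x ⬝ᵥ M *ᵥ x := by
  simpa using hM.dotProduct_mulVec_pos hx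

lemma isCompact_unit : IsCompact {x : Fin d → ℝ | euclNorm x = 1} := by
  apply Metric.isCompact_of_isClosed_isBounded
  · exact isClosed_eq continuous_euclNorm continuous_const
  · refine (Metric.isBounded_closedBall (x := (0 : Fin d → ℝ)) (r := 1)).subset ?_
    intro x hx
    rw [mem_closedBall_zero_iff, pi_norm_le_iff_of_nonneg zero_le_one]
    intro i
    have h : euclNorm x = 1 := hx
    have h2 := euclNorm_sq x
    rw [h] at h2
    have := Finset.single_le_sum (f := fun i => x i ^ 2) (fun i _ => sq_nonneg _) (Finset.mem_univ i)
    rw [Real.norm_eq_abs]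
    apply abs_le_of_sq_le_sq _ zero_le_one
    linarith

lemma lambdaMin_pos (hd : 1 ≤ d) {K : Matrix (Fin d) (Fin d) ℝ} (hK : K.PosDef) :
    0 < lambdaMin K := by
  obtain ⟨x, hx, hmin⟩ := isCompact_unit.exists_isMinOn
    (f := fun x : Fin d → ℝ => x ⬝ᵥ K *ᵥ x) ⟨_, unit_single ⟨0, hd⟩⟩ (by fun_prop)
  have hx0 : x ≠ 0 := by
    rintro rfl
    have : euclNorm (0 : Fin d → ℝ) = 1 := hx
    simp [euclNorm] at this
  refine (posDef_quad_pos hK hx0).trans_le ?_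
  unfold lambdaMin
  refine le_csInf ⟨_, x, hx, rfl⟩ ?_
  rintro r ⟨y, hy, rfl⟩
  exact hmin hy

lemma lambdaMin_quad {K : Matrix (Fin d) (Fin d) ℝ} (hK : K.PosDef) (x : Fin d → ℝ) :
    lambdaMin K * ∑ i, x i ^ 2 ≤ x ⬝ᵥ K *ᵥ x := by
  by_cases hx : x = 0
  · simp [hx]
  obtain ⟨y, hy, hxy⟩ := exists_unit x hx
  have h1 : lambdaMin K ≤ y ⬝ᵥ K *ᵥ y := by
    unfold lambdaMin
    refine csInf_le ?_ ⟨y, hy, rfl⟩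
    refine ⟨0, ?_⟩
    rintro r ⟨z, hz, rfl⟩
    simpa using hK.posSemidef.dotProduct_mulVec_nonneg z
  have h2 : x ⬝ᵥ K *ᵥ x = euclNorm x ^ 2 * (y ⬝ᵥ K *ᵥ y) := by
    conv_lhs => rw [hxy]
    simp [Matrix.mulVec_smul]; ring
  rw [h2, ← euclNorm_sq]
  nlinarith [sq_nonneg (euclNorm x)]

lemma isHerm_iff {M : Matrix (Fin d) (Fin d) ℝ} : M.IsHermitian ↔ Mᵀ = M := by
  rw [Matrix.IsHermitian, Matrix.conjTranspose_eq_transpose_of_trivial]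

lemma psd_of_quad {M : Matrix (Fin d) (Fin d) ℝ} (hM : Mᵀ = M)
    (h : ∀ x : Fin d → ℝ, 0 ≤ x ⬝ᵥ M *ᵥ x) : M.PosSemidef :=
  .of_dotProduct_mulVec_nonneg (isHerm_iff.2 hM) (by simpa using h)

lemma pd_of_quad {M : Matrix (Fin d) (Fin d) ℝ} (hM : Mᵀ = M)
    (h : ∀ x : Fin d → ℝ, x ≠ 0 → 0 < x ⬝ᵥ M *ᵥ x) : M.PosDef :=
  .of_dotProduct_mulVec_pos (isHerm_iff.2 hM) (by simpa using h)

/-- `K + tB` is positive definite for `|t| < 2` when `‖B‖ ≤ λ/2`. -/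
lemma pd_interp (hd : 1 ≤ d) {K B : Matrix (Fin d) (Fin d) ℝ} (hK : K.PosDef) (hB : Bᵀ = B)
    (hop : opNorm B ≤ lambdaMin K / 2) {t : ℝ} (ht : |t| ≤ 1) : (K + t • B).PosDef := by
  apply pd_of_quad
  · rw [transpose_add, transpose_smul, hB, isHerm_iff.1 hK.1]
  intro x hx
  have h1 := lambdaMin_quad hK x
  have h2 := quad_le hd hop x
  have h3 : 0 < ∑ i, x i ^ 2 := by
    rw [← euclNorm_sq]
    exact pow_pos (lt_of_le_of_ne (euclNorm_nonneg x) (fun h => hx (euclNorm_eq_zero h.symm))) 2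
  have h4 := lambdaMin_pos hd hK
  rw [Matrix.add_mulVec, dotProduct_add, Matrix.smul_mulVec, dotProduct_smul, smul_eq_mul]
  have h5 : |t * (x ⬝ᵥ B *ᵥ x)| ≤ 1 * (lambdaMin K / 2 * ∑ i, x i ^ 2) := by
    rw [abs_mul]
    exact mul_le_mul ht h2 (abs_nonneg _) zero_le_one
  have := (abs_le.1 h5).1
  nlinarith

lemma hsNorm_mul_sq_le (M N : Matrix (Fin d) (Fin d) ℝ) :
    hsNorm (M * N) ^ 2 ≤ hsNorm M ^ 2 * hsNorm N ^ 2 := by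
  rw [hsNorm_sq, hsNorm_sq, hsNorm_sq, Finset.sum_mul]
  apply Finset.sum_le_sum
  intro i _
  rw [Finset.sum_comm (f := fun i j => N i j ^ 2), Finset.mul_sum]
  apply Finset.sum_le_sum
  intro j _
  rw [Matrix.mul_apply]
  exact Finset.sum_mul_sq_le_sq_mul_sq _ _ _

lemma trace_sq_le (M : Matrix (Fin d) (Fin d) ℝ) : (M * M).trace ≤ hsNorm M ^ 2 := by
  rw [hsNorm_sq]
  have h : (M * M).trace = ∑ i, ∑ j, M i j * M j i := by
    simp [Matrix.trace, Matrix.mul_apply]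
  have h2 : ∑ i, ∑ j, M i j ^ 2 = ∑ i, ∑ j, M j i ^ 2 := Finset.sum_comm
  have h3 : 2 * (M * M).trace ≤ ∑ i, ∑ j, M i j ^ 2 + ∑ i, ∑ j, M j i ^ 2 := by
    rw [h, Finset.mul_sum, ← Finset.sum_add_distrib]
    apply Finset.sum_le_sum
    intro i _
    rw [Finset.mul_sum, ← Finset.sum_add_distrib]
    apply Finset.sum_le_sum
    intro j _
    nlinarith [sq_nonneg (M i j - M j i)]
  linarith

/-- The matrix inequalities for the averaged perturbation `S`. -/
lemma trace_bounds {K S : Matrix (Fin d) (Fin d) ℝ} (hK : K.PosDef) (hS : Sᵀ = S)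
    (hq : ∀ x : Fin d → ℝ, |x ⬝ᵥ S *ᵥ x| ≤ lambdaMin K / 2 * ∑ i, x i ^ 2) :
    0 ≤ (S * K⁻¹ * S * K⁻¹ * S * K⁻¹).trace + (1/2) * (S * K⁻¹ * S * K⁻¹).trace ∧
    (S * K⁻¹ * S * K⁻¹).trace ≤ d / 4 ∧
    (S * K⁻¹ * S * K⁻¹).trace ≤ hsNorm K⁻¹ ^ 2 * hsNorm S ^ 2 ∧ 
    (d : ℝ) ^ 2 ≤ hsNorm K⁻¹ ^ 2 * hsNorm K ^ 2 := by
  have hKt : Kᵀ = K := isHerm_iff.1 hK.1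
  have hW : (K⁻¹).PosDef := hK.inv
  have hWt : (K⁻¹)ᵀ = K⁻¹ := isHerm_iff.1 hW.1
  have hdet : IsUnit K.det := (Matrix.isUnit_iff_isUnit_det K).1 hK.isUnit
  have hKW : K * K⁻¹ = 1 := Matrix.mul_nonsing_inv K hdet
  have hWK : K⁻¹ * K = 1 := Matrix.nonsing_inv_mul K hdet
  have hp : ((1/2 : ℝ) • K + S).PosSemidef := by
    apply psd_of_quad (by simp [hKt, hS])
    intro x
    have h1 := lambdaMin_quad hK x
    have h2 := (abs_le.1 (hq x)).1
    rw [Matrix.add_mulVec, dotProduct_add, Matrix.smul_mulVec, dotProduct_smul, smul_eq_mul]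
    linarith
  have hm : ((1/2 : ℝ) • K - S).PosSemidef := by
    apply psd_of_quad (by simp [hKt, hS])
    intro x
    have h1 := lambdaMin_quad hK x
    have h2 := (abs_le.1 (hq x)).2
    rw [Matrix.sub_mulVec, dotProduct_sub, Matrix.smul_mulVec, dotProduct_smul, smul_eq_mul]
    linarith
  generalize hWdef : K⁻¹ = W at *
  refine ⟨?_, ?_, ?_, ?_⟩
  · have h1 : (S * W * ((1/2 : ℝ) • K + S) * (W * S)).PosSemidef := by
      have := hp.mul_mul_conjTranspose_same (S * W)
      rwa [Matrix.conjTranspose_eq_transpose_of_trivial, Matrix.transpose_mul, hWt, hS] at this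
    have h2 := psd_trace_mul_nonneg h1 hW.posSemidef
    have h3 : S * W * ((1/2 : ℝ) • K + S) * (W * S) * W
        = S * W * S * W * S * W + (1/2 : ℝ) • (S * W * S * W) := by
      have : S * W * ((1/2 : ℝ) • K + S) * (W * S) * W = (1/2 : ℝ) • (S * (W * K) * W * S * W)
        + S * W * S * W * S * W := by
        simp only [Matrix.mul_add, Matrix.add_mul, Matrix.mul_smul, Matrix.smul_mul, Matrix.mul_assoc]
      rw [this, hWK, Matrix.mul_one, add_comm]
    rw [h3, Matrix.trace_add, Matrix.trace_smul, smul_eq_mul] at h2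
    exact h2
  · have h1 : (W * ((1/2 : ℝ) • K + S) * W).PosSemidef := by
      have := hp.mul_mul_conjTranspose_same W
      rwa [Matrix.conjTranspose_eq_transpose_of_trivial, hWt] at this
    have h2 := psd_trace_mul_nonneg hm h1
    have h3 : ((1/2 : ℝ) • K - S) * (W * ((1/2 : ℝ) • K + S) * W)
        = (1/4 : ℝ) • ((K * W) * (K * W)) + (1/2 : ℝ) • ((K * W) * (S * W))
          - (1/2 : ℝ) • ((S * W) * (K * W)) - S * W * S * W := by
      simp only [Matrix.mul_add, Matrix.add_mul, Matrix.sub_mul, Matrix.mul_smul, Matrix.smul_mul, Matrix.mul_assoc, smul_add, smul_sub, smul_smul]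
      norm_num
      abel
    rw [h3, hKW] at h2
    simp only [Matrix.one_mul, Matrix.mul_one, Matrix.trace_sub, Matrix.trace_add, Matrix.trace_smul, Matrix.trace_one, Fintype.card_fin, smul_eq_mul] at h2
    linarith
  · have h1 := trace_sq_le (S * W)
    have h2 := hsNorm_mul_sq_le S W
    rw [← Matrix.mul_assoc] at h1
    linarith
  · have h2 : (W * K).trace = ∑ i, ∑ j, W i j * K i j := by
      simp only [Matrix.trace, Matrix.mul_apply, Matrix.diag]
      refine Finset.sum_congr rfl fun i _ => Finset.sum_congr rfl fun j _ => ?_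
      conv_lhs => rw [← hKt, Matrix.transpose_apply]
    rw [hWK, Matrix.trace_one, Fintype.card_fin] at h2
    rw [h2, hsNorm_sq, hsNorm_sq]
    simp only [← Finset.sum_product']
    exact Finset.sum_mul_sq_le_sq_mul_sq _ _ _

end LinAlg


section Stein
variable {d : ℕ}

/-- subexponential-in-square growth -/
def SubG (f : (Fin d → ℝ) → ℝ) : Prop :=
  ∀ ε : ℝ, 0 < ε → ∃ C : ℝ, 0 ≤ C ∧ ∀ x, |f x| ≤ C * Real.exp (ε * ∑ i, x i ^ 2)

lemma SubG.add {f g : (Fin d → ℝ) → ℝ} (hf : SubG f) (hg : SubG g) : SubG (fun x => f x + g x) := by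
  intro ε hε
  obtain ⟨C, hC, h1⟩ := hf ε hε
  obtain ⟨D, hD, h2⟩ := hg ε hε
  refine ⟨C + D, by positivity, fun x => ?_⟩
  rw [add_mul]
  exact (abs_add_le _ _).trans (add_le_add (h1 x) (h2 x))

lemma SubG.mul {f g : (Fin d → ℝ) → ℝ} (hf : SubG f) (hg : SubG g) : SubG (fun x => f x * g x) := by
  intro ε hε
  obtain ⟨C, hC, h1⟩ := hf (ε/2) (by positivity)
  obtain ⟨D, hD, h2⟩ := hg (ε/2) (by positivity)
  refine ⟨C * D, by positivity, fun x => ?_⟩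
  have : Real.exp (ε * ∑ i, x i ^ 2) = Real.exp (ε / 2 * ∑ i, x i ^ 2) * Real.exp (ε / 2 * ∑ i, x i ^ 2) := by
    rw [← Real.exp_add]; ring_nf
  rw [abs_mul, this]
  calc _ ≤ (C * Real.exp (ε / 2 * ∑ i, x i ^ 2)) * (D * Real.exp (ε / 2 * ∑ i, x i ^ 2)) :=
        mul_le_mul (h1 x) (h2 x) (abs_nonneg _) (by positivity)
    _ = _ := by ring

lemma SubG.const (c : ℝ) : SubG (fun _ : Fin d → ℝ => c) := by
  intro ε hε
  refine ⟨|c|, abs_nonneg _, fun x => ?_⟩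
  have : 1 ≤ Real.exp (ε * ∑ i, x i ^ 2) :=
    Real.one_le_exp (mul_nonneg hε.le (Finset.sum_nonneg fun _ _ => sq_nonneg _))
  nlinarith [abs_nonneg c]

lemma SubG.coord (j : Fin d) : SubG (fun x : Fin d → ℝ => x j) := by
  intro ε hε
  refine ⟨1 + 1/ε, by positivity, fun x => ?_⟩
  have h1 := Real.add_one_le_exp (ε * ∑ i, x i ^ 2)
  have h2 := Finset.single_le_sum (f := fun i => x i ^ 2) (fun i _ => sq_nonneg _) (Finset.mem_univ j)
  have h3 : |x j| ≤ 1 + x j ^ 2 := by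
    rw [← sq_abs]; nlinarith [sq_nonneg (|x j| - 1), abs_nonneg (x j)]
  have h4 : 0 ≤ ε * ∑ i, x i ^ 2 := (mul_nonneg hε.le (Finset.sum_nonneg fun _ _ => sq_nonneg _))
  calc |x j| ≤ 1 + ∑ i, x i ^ 2 := h3.trans (by simpa using h2)
    _ ≤ (1 + 1/ε) * (1 + ε * ∑ i, x i ^ 2) := by
        have : (1 + 1/ε) * (1 + ε * ∑ i, x i ^ 2) = 1 + ∑ i, x i ^ 2 + 1/ε + ε * ∑ i, x i ^ 2 := by
          field_simp; ring
        have : 0 < 1/ε := by positivity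
        linarith
    _ ≤ _ := by
        apply mul_le_mul_of_nonneg_left _ (by positivity)
        linarith

lemma SubG.sum {ι : Type*} (s : Finset ι) {f : ι → (Fin d → ℝ) → ℝ} (h : ∀ i, SubG (f i)) :
    SubG (fun x => ∑ i ∈ s, f i x) := by
  classical
  induction s using Finset.induction_on with
  | empty => simpa using SubG.const 0
  | insert a s ha ih =>
    simp only [Finset.sum_insert ha]
    exact (h a).add ih

lemma SubG.poly (W : Matrix (Fin d) (Fin d) ℝ) (p : MvPolynomial (Fin d) ℝ) :
    SubG (fun x => MvPolynomial.eval (W *ᵥ x) p) := by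
  induction p using MvPolynomial.induction_on with
  | C a => simpa using SubG.const a
  | add p q hp hq => simpa using hp.add hq
  | mul_X p i hp =>
    simp only [map_mul, MvPolynomial.eval_X]
    refine hp.mul ?_
    simp only [Matrix.mulVec, dotProduct]
    exact SubG.sum _ fun j => (SubG.const _).mul (SubG.coord j)

lemma continuous_eval_mulVec (W : Matrix (Fin d) (Fin d) ℝ) (p : MvPolynomial (Fin d) ℝ) :
    Continuous (fun x => MvPolynomial.eval (W *ᵥ x) p) :=
  (MvPolynomial.continuous_eval p).comp (by fun_prop)

lemma continuous_gaussDensity (K : Matrix (Fin d) (Fin d) ℝ) : Continuous (gaussDensity K) := by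
  unfold gaussDensity; fun_prop

lemma gaussDensity_pos {K : Matrix (Fin d) (Fin d) ℝ} (hK : K.PosDef) (x : Fin d → ℝ) :
    0 < gaussDensity K x := by
  unfold gaussDensity
  have := hK.det_pos
  positivity

lemma integrable_gauss (hd : 1 ≤ d) {K : Matrix (Fin d) (Fin d) ℝ} (hK : K.PosDef)
    {f : (Fin d → ℝ) → ℝ} (hf : SubG f) (hfc : Continuous f) :
    Integrable (fun x => f x * gaussDensity K x) := by
  set c := lambdaMin K⁻¹ with hc
  have hcpos : 0 < c := lambdaMin_pos hd hK.inv
  obtain ⟨C, hC, hb⟩ := hf (c/4) (by positivity)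
  have h1 : Integrable (fun x : Fin d → ℝ => ∏ i, Real.exp (-(c/4) * x i ^ 2)) :=
    Integrable.fintype_prod (f := fun _ (v : ℝ) => Real.exp (-(c/4) * v ^ 2))
      (fun i => integrable_exp_neg_mul_sq (by positivity))
  refine (h1.const_mul (C * (Real.sqrt ((2 * Real.pi) ^ d * K.det))⁻¹)).mono' 
    (hfc.mul (continuous_gaussDensity K)).aestronglyMeasurable (Filter.Eventually.of_forall fun x => ?_)
  rw [← Real.exp_sum, norm_mul, Real.norm_eq_abs, Real.norm_eq_abs, abs_of_pos (gaussDensity_pos hK x)]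
  have h2 := lambdaMin_quad hK.inv x
  rw [← hc] at h2
  unfold gaussDensity
  set n := (Real.sqrt ((2 * Real.pi) ^ d * K.det))⁻¹
  have hn : 0 ≤ n := by positivity
  calc |f x| * (n * Real.exp (-(1 / 2) * x ⬝ᵥ K⁻¹ *ᵥ x))
      ≤ (C * Real.exp (c / 4 * ∑ i, x i ^ 2)) * (n * Real.exp (-(c/2) * ∑ i, x i ^ 2)) := by
        refine mul_le_mul (hb x) ?_ (by positivity) (by positivity)
        refine mul_le_mul_of_nonneg_left (Real.exp_le_exp.2 (by linarith)) hn
    _ = C * n * (Real.exp (c / 4 * ∑ i, x i ^ 2) * Real.exp (-(c/2) * ∑ i, x i ^ 2)) := by ring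
    _ = _ := by
        rw [← Real.exp_add, ← Finset.mul_sum]; ring_nf

lemma integral_gaussLaw {K : Matrix (Fin d) (Fin d) ℝ} (hK : K.PosDef) (f : (Fin d → ℝ) → ℝ) :
    ∫ x, f x ∂(gaussLaw K) = ∫ x, f x * gaussDensity K x := by
  unfold gaussLaw
  rw [integral_withDensity_eq_integral_toReal_smul
    ((continuous_gaussDensity K).measurable.ennreal_ofReal) (by simp)]
  refine integral_congr_ae (Filter.Eventually.of_forall fun x => ?_)
  simp [ENNReal.toReal_ofReal (gaussDensity_pos hK x).le, mul_comm]

lemma integrable_gaussLaw {K : Matrix (Fin d) (Fin d) ℝ} (hK : K.PosDef) (f : (Fin d → ℝ) → ℝ)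
    (h : Integrable (fun x => f x * gaussDensity K x)) : Integrable f (gaussLaw K) := by
  unfold gaussLaw
  rw [integrable_withDensity_iff ((continuous_gaussDensity K).measurable.ennreal_ofReal) (by simp)]
  refine h.congr (Filter.Eventually.of_forall fun x => ?_)
  simp [ENNReal.toReal_ofReal (gaussDensity_pos hK x).le]

lemma integrable_poly (hd : 1 ≤ d) {K : Matrix (Fin d) (Fin d) ℝ} (hK : K.PosDef)
    (p : MvPolynomial (Fin d) ℝ) :
    Integrable (fun x => MvPolynomial.eval (K⁻¹ *ᵥ x) p) (gaussLaw K) :=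
  integrable_gaussLaw hK _ (integrable_gauss hd hK (SubG.poly _ p) (continuous_eval_mulVec _ p))

/-- derivation `D_i` with `D_i X_j = W i j` -/
noncomputable def Dv (W : Matrix (Fin d) (Fin d) ℝ) (i : Fin d) :
    Derivation ℝ (MvPolynomial (Fin d) ℝ) (MvPolynomial (Fin d) ℝ) :=
  MvPolynomial.mkDerivation ℝ (fun j => MvPolynomial.C (W i j))

lemma hasLineDeriv_poly {W : Matrix (Fin d) (Fin d) ℝ} (hW : Wᵀ = W) (i : Fin d)
    (p : MvPolynomial (Fin d) ℝ) (x : Fin d → ℝ) :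
    HasLineDerivAt ℝ (fun x => MvPolynomial.eval (W *ᵥ x) p)
      (MvPolynomial.eval (W *ᵥ x) (Dv W i p)) x (Pi.single i 1) := by
  unfold HasLineDerivAt
  induction p using MvPolynomial.induction_on with
  | C a =>
    have : Dv W i (MvPolynomial.C a) = 0 := (Dv W i).map_algebraMap a
    simpa [this] using hasDerivAt_const (0:ℝ) a
  | add p q hp hq => simpa using! hp.add hq
  | mul_X p j hp =>
    have h1 : HasDerivAt (fun t : ℝ => (W *ᵥ (x + t • Pi.single i 1)) j) (W i j) 0 := by
      have : (fun t : ℝ => (W *ᵥ (x + t • Pi.single i 1)) j) = fun t => (W *ᵥ x) j + t * W i j := by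
        funext t
        conv_rhs => rw [← hW]
        simp [Matrix.mulVec_add, Matrix.mulVec_smul]
        rw [hW]
      rw [this]
      simpa using ((hasDerivAt_id (0:ℝ)).mul_const (W i j)).const_add ((W *ᵥ x) j)
    have h2 := hp.mul h1
    have h3 : Dv W i (p * MvPolynomial.X j) = p * MvPolynomial.C (W i j) + MvPolynomial.X j * Dv W i p := by
      rw [Derivation.leibniz]
      simp [Dv, MvPolynomial.mkDerivation_X]
    rw [h3]
    simp only [map_mul, map_add, MvPolynomial.eval_X, MvPolynomial.eval_C]
    refine HasDerivAt.congr_deriv h2 ?_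
    simp only [zero_smul, add_zero]; ring

lemma hasLineDeriv_gauss {K : Matrix (Fin d) (Fin d) ℝ} (hK : K.PosDef) (i : Fin d) (x : Fin d → ℝ) :
    HasLineDerivAt ℝ (gaussDensity K) (-((K⁻¹ *ᵥ x) i * gaussDensity K x)) x (Pi.single i 1) := by
  unfold HasLineDerivAt gaussDensity
  have hWt : (K⁻¹)ᵀ = K⁻¹ := isHerm_iff.1 hK.inv.1
  generalize K⁻¹ = W at *
  have h1 : HasDerivAt (fun t : ℝ => -(1/2) * ((x + t • Pi.single i 1) ⬝ᵥ W *ᵥ (x + t • Pi.single i 1)))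
      (- (W *ᵥ x) i) 0 := by
    have : (fun t : ℝ => -(1/2) * ((x + t • Pi.single i 1) ⬝ᵥ W *ᵥ (x + t • Pi.single i 1))) =
       fun t => -(1/2) * (x ⬝ᵥ W *ᵥ x) - t * (W *ᵥ x) i - 1/2 * W i i * t ^ 2 := by
      funext t
      have h : x ⬝ᵥ W *ᵥ (Pi.single i 1) = (W *ᵥ x) i := by
        rw [Matrix.dotProduct_mulVec, ← Matrix.mulVec_transpose, hWt, dotProduct_single, mul_one]
      rw [Matrix.mulVec_add, Matrix.mulVec_smul, add_dotProduct, dotProduct_add, dotProduct_add,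
        smul_dotProduct, smul_dotProduct, dotProduct_smul, dotProduct_smul, h]
      simp
      ring
    rw [this]
    have := (((hasDerivAt_id (0:ℝ)).mul_const ((W *ᵥ x) i)).const_sub (-(1/2) * (x ⬝ᵥ W *ᵥ x))).sub (((hasDerivAt_id (0:ℝ)).pow 2).const_mul (1/2 * W i i))
    simpa using! this
  have := h1.exp.const_mul (Real.sqrt ((2 * Real.pi) ^ d * K.det))⁻¹
  refine HasDerivAt.congr_deriv this ?_
  simp only [zero_smul, add_zero]; ring

/-- Gaussian integration by parts. -/
lemma stein (hd : 1 ≤ d) {K : Matrix (Fin d) (Fin d) ℝ} (hK : K.PosDef) (i : Fin d)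
    (p : MvPolynomial (Fin d) ℝ) :
    ∫ x, MvPolynomial.eval (K⁻¹ *ᵥ x) (MvPolynomial.X i * p) ∂(gaussLaw K) =
    ∫ x, MvPolynomial.eval (K⁻¹ *ᵥ x) (Dv K⁻¹ i p) ∂(gaussLaw K) := by
  rw [integral_gaussLaw hK, integral_gaussLaw hK]
  have hWt : (K⁻¹)ᵀ = K⁻¹ := isHerm_iff.1 hK.inv.1
  have key := integral_bilinear_hasLineDerivAt_right_eq_neg_left_of_integrable
    (B := ContinuousLinearMap.mul ℝ ℝ) (μ := (volume : Measure (Fin d → ℝ)))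
    (f := fun x => MvPolynomial.eval (K⁻¹ *ᵥ x) p)
    (f' := fun x => MvPolynomial.eval (K⁻¹ *ᵥ x) (Dv K⁻¹ i p))
    (g := gaussDensity K) (g' := fun x => -((K⁻¹ *ᵥ x) i * gaussDensity K x)) (v := Pi.single i 1)
    (integrable_gauss hd hK (SubG.poly _ _) (continuous_eval_mulVec _ _))
    ?_
    (integrable_gauss hd hK (SubG.poly _ _) (continuous_eval_mulVec _ _))
    (fun x _ => hasLineDeriv_poly hWt i p x)
    (fun x _ => hasLineDeriv_gauss hK i x)
  · simp only [ContinuousLinearMap.mul_apply'] at key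
    rw [← neg_inj, ← key, ← integral_neg]
    refine integral_congr_ae (Filter.Eventually.of_forall fun x => ?_)
    simp; ring
  · refine (integrable_gauss hd hK (SubG.poly K⁻¹ (MvPolynomial.X i * p)) (continuous_eval_mulVec _ _)).neg.congr
      (Filter.Eventually.of_forall fun x => ?_)
    simp; ring

end Stein


section Moments
variable {d : ℕ}

/-- linear form as a polynomial -/
noncomputable def linP (v : Fin d → ℝ) : MvPolynomial (Fin d) ℝ :=
  ∑ b, v b • MvPolynomial.X b

/-- centred quadratic form as a polynomial -/
noncomputable def Qp (W S : Matrix (Fin d) (Fin d) ℝ) : MvPolynomial (Fin d) ℝ :=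
  (∑ a, ∑ b, S a b • (MvPolynomial.X a * MvPolynomial.X b)) - (S * W).trace • 1

lemma Dv_X (W : Matrix (Fin d) (Fin d) ℝ) (i j : Fin d) :
    Dv W i (MvPolynomial.X j) = W i j • 1 := by
  simp [Dv, MvPolynomial.mkDerivation_X, MvPolynomial.smul_eq_C_mul]

lemma Dv_lin (W : Matrix (Fin d) (Fin d) ℝ) (i : Fin d) (v : Fin d → ℝ) :
    Dv W i (linP v) = (W *ᵥ v) i • 1 := by
  simp only [linP, map_sum, Derivation.map_smul, Dv_X, smul_smul, ← Finset.sum_smul]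
  congr 1
  simp [Matrix.mulVec, dotProduct, mul_comm]

lemma Dv_Q {W S : Matrix (Fin d) (Fin d) ℝ} (hS : Sᵀ = S) (i : Fin d) :
    Dv W i (Qp W S) = (2:ℝ) • linP ((W * S) i) := by
  have h1 : Dv W i (Qp W S) = ∑ a, ∑ b, S a b • (W i b • MvPolynomial.X a + W i a • MvPolynomial.X b) := by
    simp only [Qp, map_sub, map_sum, Derivation.map_smul, Derivation.leibniz, Dv_X,
      Derivation.map_one_eq_zero, smul_zero, sub_zero]
    refine Finset.sum_congr rfl fun a _ => Finset.sum_congr rfl fun b _ => ?_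
    simp [MvPolynomial.smul_eq_C_mul, mul_comm]
  have h2 : ∑ a, ∑ b, (S a b * W i b) • (MvPolynomial.X a : MvPolynomial (Fin d) ℝ) = linP ((W * S) i) := by
    unfold linP
    refine Finset.sum_congr rfl fun a _ => ?_
    rw [← Finset.sum_smul]
    congr 1
    rw [Matrix.mul_apply]
    refine Finset.sum_congr rfl fun b _ => ?_
    rw [mul_comm]; congr 1
    conv_lhs => rw [← hS, Matrix.transpose_apply]
  have h3 : ∑ a, ∑ b, (S a b * W i a) • (MvPolynomial.X b : MvPolynomial (Fin d) ℝ) = linP ((W * S) i) := by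
    rw [Finset.sum_comm, ← h2]
    refine Finset.sum_congr rfl fun a _ => Finset.sum_congr rfl fun b _ => ?_
    congr 2
    conv_lhs => rw [← hS, Matrix.transpose_apply]
  rw [h1, two_smul]
  nth_rw 1 [← h2]
  rw [← h3]
  simp only [smul_add, smul_smul, Finset.sum_add_distrib]

lemma Dv_Dv_Q {W S : Matrix (Fin d) (Fin d) ℝ} (hW : Wᵀ = W) (hS : Sᵀ = S) (i j : Fin d) :
    Dv W i (Dv W j (Qp W S)) = (2 * (W * S * W) j i) • 1 := by
  rw [Dv_Q hS, Derivation.map_smul, Dv_lin, smul_smul]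
  congr 2
  rw [Matrix.mul_apply]
  simp only [Matrix.mulVec, dotProduct]
  refine Finset.sum_congr rfl fun b _ => ?_
  rw [mul_comm]; congr 1
  conv_lhs => rw [← hW, Matrix.transpose_apply]

variable {W : Matrix (Fin d) (Fin d) ℝ} (L : MvPolynomial (Fin d) ℝ →ₗ[ℝ] ℝ)

lemma L_Q_mul (hW : Wᵀ = W) (hL : ∀ i p, L (MvPolynomial.X i * p) = L (Dv W i p))
    (S : Matrix (Fin d) (Fin d) ℝ) (f : MvPolynomial (Fin d) ℝ) :
    L (Qp W S * f) = ∑ a, ∑ b, S a b * L (Dv W b (Dv W a f)) := by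
  have h0 : ∀ a b, L (MvPolynomial.X a * MvPolynomial.X b * f) = L (Dv W b (Dv W a f)) + W a b * L f := by
    intro a b
    rw [mul_assoc, hL, Derivation.leibniz, Dv_X, map_add, smul_eq_mul, hL]
    simp
  have h1 : (S * W).trace = ∑ a, ∑ b, S a b * W a b := by
    simp only [Matrix.trace, Matrix.mul_apply, Matrix.diag]
    refine Finset.sum_congr rfl fun a _ => Finset.sum_congr rfl fun b _ => ?_
    conv_lhs => rw [← hW, Matrix.transpose_apply]
  simp only [Qp, sub_mul, Finset.sum_mul, smul_mul_assoc, map_sub, map_sum, map_smul, h0, one_mul, h1,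
    smul_eq_mul, mul_add, Finset.sum_add_distrib]
  simp [Finset.sum_mul, mul_assoc]

lemma L_Q (hW : Wᵀ = W) (hL : ∀ i p, L (MvPolynomial.X i * p) = L (Dv W i p))
    (S : Matrix (Fin d) (Fin d) ℝ) : L (Qp W S) = 0 := by
  have := L_Q_mul L hW hL S 1
  simpa using this

lemma sum_mul_eq_trace {S M : Matrix (Fin d) (Fin d) ℝ} :
    ∑ a, ∑ b, S a b * M a b = (S * Mᵀ).trace := by
  simp [Matrix.trace, Matrix.mul_apply]

lemma L_QQ (hW : Wᵀ = W) (hL : ∀ i p, L (MvPolynomial.X i * p) = L (Dv W i p)) (h1 : L 1 = 1)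
    (T : Matrix (Fin d) (Fin d) ℝ) {S : Matrix (Fin d) (Fin d) ℝ} (hS : Sᵀ = S) :
    L (Qp W T * Qp W S) = 2 * (T * W * S * W).trace := by
  rw [L_Q_mul L hW hL]
  simp only [Dv_Dv_Q hW hS, map_smul, h1, smul_eq_mul, mul_one]
  have : (T * W * S * W) = T * (W * S * W)ᵀ := by
    simp only [Matrix.transpose_mul, hW, hS, Matrix.mul_assoc]
  rw [this, ← sum_mul_eq_trace, Finset.mul_sum]
  refine Finset.sum_congr rfl fun a _ => ?_
  rw [Finset.mul_sum]
  refine Finset.sum_congr rfl fun b _ => ?_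
  ring

lemma L_lin_lin (hL : ∀ i p, L (MvPolynomial.X i * p) = L (Dv W i p)) (h1 : L 1 = 1)
    (v w : Fin d → ℝ) : L (linP v * linP w) = v ⬝ᵥ W *ᵥ w := by
  conv_lhs => rw [linP]
  simp only [Finset.sum_mul, smul_mul_assoc, map_sum, map_smul, hL, Dv_lin, h1]
  simp [dotProduct]

lemma L_QQQ (hW : Wᵀ = W) (hL : ∀ i p, L (MvPolynomial.X i * p) = L (Dv W i p)) (h1 : L 1 = 1)
    (T : Matrix (Fin d) (Fin d) ℝ) {S : Matrix (Fin d) (Fin d) ℝ} (hS : Sᵀ = S) :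
    L (Qp W T * (Qp W S * Qp W S)) = 8 * (T * W * S * W * S * W).trace := by
  rw [L_Q_mul L hW hL]
  have h2 : ∀ a b, L (Dv W b (Dv W a (Qp W S * Qp W S))) = 8 * (W * S * W * S * W) a b := by
    intro a b
    have e1 : Dv W a (Qp W S * Qp W S) = (2:ℝ) • (Qp W S * Dv W a (Qp W S)) := by
      rw [Derivation.leibniz, smul_eq_mul, two_smul]
    rw [e1, Derivation.map_smul, Derivation.leibniz, Dv_Dv_Q hW hS, Dv_Q hS, Dv_Q hS]
    simp only [smul_eq_mul, mul_smul_comm, smul_mul_assoc, mul_one, map_smul, map_add, L_Q L hW hL,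
      L_lin_lin L hL h1]
    have : (W * S) a ⬝ᵥ W *ᵥ (W * S) b = (W * S * W * S * W) a b := by
      have e : W * S * W * S * W = (W * S) * (W * (W * S)ᵀ) := by
        simp only [Matrix.transpose_mul, hW, hS, Matrix.mul_assoc]
      rw [e, Matrix.mul_apply]
      rfl
    rw [this]; ring
  simp only [h2]
  have : (T * W * S * W * S * W) = T * (W * S * W * S * W)ᵀ := by
    simp only [Matrix.transpose_mul, hW, hS, Matrix.mul_assoc]
  rw [this, ← sum_mul_eq_trace, Finset.mul_sum]
  refine Finset.sum_congr rfl fun a _ => ?_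
  rw [Finset.mul_sum]
  refine Finset.sum_congr rfl fun b _ => ?_
  ring

/-- the fourth-chaos polynomial -/
noncomputable def Hp (W S : Matrix (Fin d) (Fin d) ℝ) : MvPolynomial (Fin d) ℝ :=
  (1/4 : ℝ) • (Qp W S * Qp W S) - Qp W (S * W * S) - ((1/2 : ℝ) * (S * W * S * W).trace) • 1

lemma L_QH (hW : Wᵀ = W) (hL : ∀ i p, L (MvPolynomial.X i * p) = L (Dv W i p)) (h1 : L 1 = 1)
    (T : Matrix (Fin d) (Fin d) ℝ) {S : Matrix (Fin d) (Fin d) ℝ} (hS : Sᵀ = S) :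
    L (Qp W T * Hp W S) = 0 := by
  have hS2 : (S * W * S)ᵀ = S * W * S := by
    simp only [Matrix.transpose_mul, hW, hS, Matrix.mul_assoc]
  simp only [Hp, mul_sub, mul_smul_comm, map_sub, map_smul, mul_one, L_Q L hW hL,
    L_QQ L hW hL h1 T hS2, L_QQQ L hW hL h1 T hS, smul_eq_mul]
  simp only [Matrix.mul_assoc]
  ring

lemma eval_Qp (S : Matrix (Fin d) (Fin d) ℝ) (u : Fin d → ℝ) :
    MvPolynomial.eval u (Qp W S) = u ⬝ᵥ S *ᵥ u - (S * W).trace := by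
  simp only [Qp, map_sub, map_sum, MvPolynomial.smul_eval, map_mul, MvPolynomial.eval_X, map_one, mul_one]
  congr 1
  simp only [dotProduct, Matrix.mulVec, Finset.mul_sum]
  refine Finset.sum_congr rfl fun a _ => Finset.sum_congr rfl fun b _ => ?_
  ring

lemma eval_Hp (S : Matrix (Fin d) (Fin d) ℝ) (u : Fin d → ℝ) :
    MvPolynomial.eval u (Hp W S) = 1/4 * (u ⬝ᵥ S *ᵥ u - (S * W).trace) ^ 2
      - u ⬝ᵥ (S * W * S) *ᵥ u + 1/2 * (S * W * S * W).trace := by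
  simp only [Hp, map_sub, MvPolynomial.smul_eval, map_mul, map_one, mul_one, eval_Qp]
  ring

/-- expectation functional on polynomials in `K⁻¹ x` -/
noncomputable def LK (hd : 1 ≤ d) {K : Matrix (Fin d) (Fin d) ℝ} (hK : K.PosDef) :
    MvPolynomial (Fin d) ℝ →ₗ[ℝ] ℝ where
  toFun p := ∫ x, MvPolynomial.eval (K⁻¹ *ᵥ x) p ∂(gaussLaw K)
  map_add' p q := by
    simp only [map_add]
    exact integral_add (integrable_poly hd hK p) (integrable_poly hd hK q)
  map_smul' c p := by
    simp only [MvPolynomial.smul_eval, RingHom.id_apply, smul_eq_mul]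
    exact integral_const_mul _ _

end Moments


section Deriv
variable {d : ℕ}

lemma hasDerivAt_det {K B : Matrix (Fin d) (Fin d) ℝ} {t : ℝ} (h : (K + t • B).det ≠ 0) :
    HasDerivAt (fun s : ℝ => (K + s • B).det)
      ((K + t • B).det * ((K + t • B)⁻¹ * B).trace) t := by
  set Γ := K + t • B with hΓ
  have hu : IsUnit Γ.det := isUnit_iff_ne_zero.2 h
  set M := Γ⁻¹ * B with hM
  have e1 : (fun s : ℝ => (K + s • B).det) = fun s => Γ.det *
      (Polynomial.eval (s - t) (det (1 + (Polynomial.X : Polynomial ℝ) • M.map Polynomial.C))) := by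
    funext s
    have h2 : K + s • B = Γ * (1 + (s - t) • M) := by
      rw [Matrix.mul_add, Matrix.mul_one, Matrix.mul_smul, hM, ← Matrix.mul_assoc,
        Matrix.mul_nonsing_inv _ hu, Matrix.one_mul, hΓ, sub_smul]
      abel
    rw [h2, Matrix.det_mul]
    congr 1
    rw [← Polynomial.coe_evalRingHom, RingHom.map_det]
    congr 1
    ext i j
    simp [Matrix.one_apply, apply_ite]
    ring
  rw [e1]
  have h3 := (Polynomial.hasDerivAt
    (det (1 + (Polynomial.X : Polynomial ℝ) • M.map Polynomial.C)) (t - t))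
  rw [sub_self, Matrix.derivative_det_one_add_X_smul] at h3
  have h4 : HasDerivAt (fun s : ℝ => s - t) 1 t := (hasDerivAt_id t).sub_const t
  have h5 := (HasDerivAt.comp t (by simpa using h3) h4).const_mul Γ.det
  simpa using h5

lemma eventually_det_ne {K B : Matrix (Fin d) (Fin d) ℝ} {t : ℝ} (h : (K + t • B).det ≠ 0) :
    ∀ᶠ s in nhds t, (K + s • B).det ≠ 0 := by
  have : Continuous (fun s : ℝ => (K + s • B).det) := by fun_prop
  exact this.continuousAt.eventually_ne h

lemma continuousAt_inv' {M : Matrix (Fin d) (Fin d) ℝ} (h : M.det ≠ 0) :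
    ContinuousAt (fun N : Matrix (Fin d) (Fin d) ℝ => N⁻¹) M := by
  apply continuousAt_matrix_inv
  have : (Ring.inverse : ℝ → ℝ) = fun x => x⁻¹ := by funext x; simp
  rw [this]
  exact continuousAt_inv₀ h

lemma inv_sub {K B : Matrix (Fin d) (Fin d) ℝ} {s t : ℝ} (h : (K + t • B).det ≠ 0)
    (h' : (K + s • B).det ≠ 0) :
    (K + s • B)⁻¹ = (K + t • B)⁻¹ - (s - t) • ((K + s • B)⁻¹ * B * (K + t • B)⁻¹) := by
  set X := K + t • B with hX
  set Y := K + s • B with hY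
  have e : (s - t) • B = Y - X := by rw [hX, hY, sub_smul]; abel
  have : (s - t) • (Y⁻¹ * B * X⁻¹) = Y⁻¹ * ((s - t) • B) * X⁻¹ := by simp
  rw [this, e, Matrix.mul_sub, Matrix.sub_mul, Matrix.nonsing_inv_mul _ (isUnit_iff_ne_zero.2 h'),
    Matrix.mul_assoc, Matrix.mul_nonsing_inv _ (isUnit_iff_ne_zero.2 h)]
  simp

lemma hasDerivAt_inv1 {K B : Matrix (Fin d) (Fin d) ℝ} {t : ℝ} (h : (K + t • B).det ≠ 0)
    (l : Matrix (Fin d) (Fin d) ℝ →ₗ[ℝ] ℝ) (hl : Continuous l) :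
    HasDerivAt (fun s : ℝ => l (K + s • B)⁻¹)
      (-l ((K + t • B)⁻¹ * B * (K + t • B)⁻¹)) t := by
  rw [hasDerivAt_iff_tendsto_slope]
  have hc : ContinuousAt (fun s : ℝ => (K + s • B)⁻¹) t :=
    ContinuousAt.comp (f := fun s : ℝ => K + s • B) (g := fun N => N⁻¹) (continuousAt_inv' h) (by fun_prop)
  have h1 : Filter.Tendsto (fun s : ℝ => -l ((K + s • B)⁻¹ * B * (K + t • B)⁻¹)) (nhdsWithin t {t}ᶜ)
      (nhds (-l ((K + t • B)⁻¹ * B * (K + t • B)⁻¹))) := by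
    refine Filter.Tendsto.mono_left ?_ nhdsWithin_le_nhds
    have : ContinuousAt (fun s : ℝ => -l ((K + s • B)⁻¹ * B * (K + t • B)⁻¹)) t := by
      have : Continuous (fun N : Matrix (Fin d) (Fin d) ℝ => -l (N * B * (K + t • B)⁻¹)) := by fun_prop
      exact ContinuousAt.comp (g := fun N : Matrix (Fin d) (Fin d) ℝ => -l (N * B * (K + t • B)⁻¹)) this.continuousAt hc
    exact this
  refine h1.congr' ?_
  filter_upwards [(eventually_det_ne h).filter_mono nhdsWithin_le_nhds, self_mem_nhdsWithin] with s hs hst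
  have hne : s - t ≠ 0 := sub_ne_zero.2 hst
  rw [slope_def_field, inv_sub h hs, map_sub, map_smul, ← inv_sub h hs]
  simp only [smul_eq_mul]
  field_simp
  ring

lemma hasDerivAt_inv2 {K B : Matrix (Fin d) (Fin d) ℝ} {t : ℝ} (h : (K + t • B).det ≠ 0)
    (l : Matrix (Fin d) (Fin d) ℝ →ₗ[ℝ] ℝ) (hl : Continuous l) :
    HasDerivAt (fun s : ℝ => l ((K + s • B)⁻¹ * B * (K + s • B)⁻¹))
      (-2 * l ((K + t • B)⁻¹ * B * (K + t • B)⁻¹ * B * (K + t • B)⁻¹)) t := by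
  rw [hasDerivAt_iff_tendsto_slope]
  have hc : ContinuousAt (fun s : ℝ => (K + s • B)⁻¹) t :=
    ContinuousAt.comp (f := fun s : ℝ => K + s • B) (g := fun N => N⁻¹) (continuousAt_inv' h) (by fun_prop)
  set R := (K + t • B)⁻¹ with hR
  have h1 : Filter.Tendsto (fun s : ℝ => -l ((K + s • B)⁻¹ * B * R * B * (K + s • B)⁻¹ + R * B * (K + s • B)⁻¹ * B * R)) (nhdsWithin t {t}ᶜ)
      (nhds (-2 * l (R * B * R * B * R))) := by
    refine Filter.Tendsto.mono_left ?_ nhdsWithin_le_nhds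
    have : ContinuousAt (fun s : ℝ => -l ((K + s • B)⁻¹ * B * R * B * (K + s • B)⁻¹ + R * B * (K + s • B)⁻¹ * B * R)) t := by
      have : Continuous (fun N : Matrix (Fin d) (Fin d) ℝ => -l (N * B * R * B * N + R * B * N * B * R)) := by fun_prop
      exact ContinuousAt.comp (g := fun N : Matrix (Fin d) (Fin d) ℝ => -l (N * B * R * B * N + R * B * N * B * R)) this.continuousAt hc
    have h2 := this.tendsto
    simp only [← hR] at h2
    convert h2 using 2
    rw [map_add]; ring
  refine h1.congr' ?_
  filter_upwards [(eventually_det_ne h).filter_mono nhdsWithin_le_nhds, self_mem_nhdsWithin] with s hs hst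
  have hne : s - t ≠ 0 := sub_ne_zero.2 hst
  have e1 := inv_sub h hs
  rw [← hR] at e1
  set Y := (K + s • B)⁻¹ with hY
  have e3 : Y * B * Y - R * B * R = -(s - t) • (Y * B * R * B * Y + R * B * Y * B * R) := by
    have a1 : Y - R = -(s - t) • (Y * B * R) := by rw [neg_smul, sub_eq_iff_eq_add', ← sub_eq_add_neg]; exact e1
    have : Y * B * Y - R * B * R = (Y - R) * (B * Y) + R * B * (Y - R) := by
      simp only [Matrix.sub_mul, Matrix.mul_sub, Matrix.mul_assoc]; abel
    rw [this, a1]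
    simp only [Matrix.smul_mul, Matrix.mul_smul, smul_add, Matrix.mul_assoc]
  rw [slope_def_field, ← map_sub, ← hR, ← hY, e3, map_smul, smul_eq_mul]
  field_simp

/-- log-derivative of the density -/
noncomputable def m1 (Γ B : Matrix (Fin d) (Fin d) ℝ) (x : Fin d → ℝ) : ℝ :=
  1/2 * (x ⬝ᵥ (Γ⁻¹ * B * Γ⁻¹) *ᵥ x - (Γ⁻¹ * B).trace)

noncomputable def m2 (Γ B : Matrix (Fin d) (Fin d) ℝ) (x : Fin d → ℝ) : ℝ :=
  - (x ⬝ᵥ (Γ⁻¹ * B * Γ⁻¹ * B * Γ⁻¹) *ᵥ x) + 1/2 * (Γ⁻¹ * B * Γ⁻¹ * B).trace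

/-- quadratic evaluation as a linear functional of the matrix -/
noncomputable def lq (x : Fin d → ℝ) : Matrix (Fin d) (Fin d) ℝ →ₗ[ℝ] ℝ where
  toFun M := x ⬝ᵥ M *ᵥ x
  map_add' M N := by simp [Matrix.add_mulVec]
  map_smul' c M := by simp [Matrix.smul_mulVec]

noncomputable def ltr (B : Matrix (Fin d) (Fin d) ℝ) : Matrix (Fin d) (Fin d) ℝ →ₗ[ℝ] ℝ where
  toFun M := (M * B).trace
  map_add' M N := by simp [Matrix.add_mul]
  map_smul' c M := by simp

lemma continuous_lq (x : Fin d → ℝ) : Continuous (lq x) := by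
  change Continuous fun M : Matrix (Fin d) (Fin d) ℝ => x ⬝ᵥ M *ᵥ x
  fun_prop

lemma continuous_ltr (B : Matrix (Fin d) (Fin d) ℝ) : Continuous (ltr B) := by
  change Continuous fun M : Matrix (Fin d) (Fin d) ℝ => (M * B).trace
  fun_prop

lemma hasDerivAt_dens {K B : Matrix (Fin d) (Fin d) ℝ} {t : ℝ} (h : 0 < (K + t • B).det)
    (x : Fin d → ℝ) :
    HasDerivAt (fun s : ℝ => gaussDensity (K + s • B) x)
      (gaussDensity (K + t • B) x * m1 (K + t • B) B x) t := by
  have h1 := (hasDerivAt_det h.ne').const_mul ((2 * Real.pi) ^ d)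
  have hpos : 0 < (2 * Real.pi) ^ d * (K + t • B).det := by positivity
  have h2 := (h1.sqrt hpos.ne').inv (Real.sqrt_pos.2 hpos).ne'
  have h3 := ((hasDerivAt_inv1 h.ne' (lq x) (continuous_lq x)).const_mul (-(1/2))).exp
  refine (h2.mul h3).congr_deriv ?_
  simp only [gaussDensity, m1, lq, LinearMap.coe_mk, AddHom.coe_mk, Pi.inv_apply]
  set D := (2 * Real.pi) ^ d * (K + t • B).det with hD
  have hs : Real.sqrt D ^ 2 = D := Real.sq_sqrt hpos.le
  have hs0 : Real.sqrt D ≠ 0 := (Real.sqrt_pos.2 hpos).ne'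
  rw [← mul_assoc, ← hD, hs]
  field_simp
  ring

lemma hasDerivAt_m1 {K B : Matrix (Fin d) (Fin d) ℝ} {t : ℝ} (h : 0 < (K + t • B).det)
    (x : Fin d → ℝ) :
    HasDerivAt (fun s : ℝ => m1 (K + s • B) B x) (m2 (K + t • B) B x) t := by
  have h1 := hasDerivAt_inv2 h.ne' (lq x) (continuous_lq x)
  have h2 := hasDerivAt_inv1 h.ne' (ltr B) (continuous_ltr B)
  refine ((h1.sub h2).const_mul (1/2)).congr_deriv ?_
  simp only [m2, lq, ltr, LinearMap.coe_mk, AddHom.coe_mk]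
  ring

lemma hasDerivAt_dens2 {K B : Matrix (Fin d) (Fin d) ℝ} {t : ℝ} (h : 0 < (K + t • B).det)
    (x : Fin d → ℝ) :
    HasDerivAt (fun s : ℝ => gaussDensity (K + s • B) x * m1 (K + s • B) B x)
      (gaussDensity (K + t • B) x * (m1 (K + t • B) B x ^ 2 + m2 (K + t • B) B x)) t := by
  refine ((hasDerivAt_dens h x).mul (hasDerivAt_m1 h x)).congr_deriv ?_
  ring

end Deriv


section Par
variable {d : ℕ}

/-- the compact set of admissible increments -/
def BB (K : Matrix (Fin d) (Fin d) ℝ) : Set (Matrix (Fin d) (Fin d) ℝ) :=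
  {B | Bᵀ = B ∧ opNorm B ≤ lambdaMin K / 2}

lemma isClosed_BB (hd : 1 ≤ d) (K : Matrix (Fin d) (Fin d) ℝ) : IsClosed (BB K) := by
  apply IsClosed.inter
  · exact isClosed_eq (by fun_prop) (by fun_prop)
  · exact isClosed_opNorm_le hd _

lemma isCompact_BB (hd : 1 ≤ d) (K : Matrix (Fin d) (Fin d) ℝ) : IsCompact (BB K) := by
  have h : IsCompact (Set.pi Set.univ fun _ : Fin d => Set.pi Set.univ fun _ : Fin d =>
      Set.Icc (-(lambdaMin K / 2)) (lambdaMin K / 2)) :=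
    isCompact_univ_pi fun _ => isCompact_univ_pi fun _ => isCompact_Icc
  refine IsCompact.of_isClosed_subset h (isClosed_BB hd K) ?_
  intro B hB i _ j _
  exact abs_le.1 (entry_le hd hB.2 i j)

lemma det_pos_BB (hd : 1 ≤ d) {K : Matrix (Fin d) (Fin d) ℝ} (hK : K.PosDef)
    {B : Matrix (Fin d) (Fin d) ℝ} (hB : B ∈ BB K) {t : ℝ} (ht : |t| ≤ 1) :
    0 < (K + t • B).det := (pd_interp hd hK hB.1 hB.2 ht).det_pos

lemma contOn_inv (hd : 1 ≤ d) {K : Matrix (Fin d) (Fin d) ℝ} (hK : K.PosDef) :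
    ContinuousOn (fun p : ℝ × Matrix (Fin d) (Fin d) ℝ => (K + p.1 • p.2)⁻¹)
      (Set.Icc (-1) 1 ×ˢ BB K) := by
  intro p hp
  apply ContinuousAt.continuousWithinAt
  exact ContinuousAt.comp (f := fun p : ℝ × Matrix (Fin d) (Fin d) ℝ => K + p.1 • p.2)
    (g := fun N => N⁻¹) (continuousAt_inv' (det_pos_BB hd hK hp.2 (abs_le.2 hp.1)).ne') (by fun_prop)

lemma contOn_dens (hd : 1 ≤ d) {K : Matrix (Fin d) (Fin d) ℝ} (hK : K.PosDef) (x : Fin d → ℝ) :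
    ContinuousOn (fun p : ℝ × Matrix (Fin d) (Fin d) ℝ => gaussDensity (K + p.1 • p.2) x)
      (Set.Icc (-1) 1 ×ˢ BB K) := by
  unfold gaussDensity
  have h1 := contOn_inv hd hK
  apply ContinuousOn.mul
  · apply ContinuousOn.inv₀
    · apply Continuous.continuousOn; fun_prop
    · intro p hp
      have := det_pos_BB hd hK hp.2 (abs_le.2 hp.1)
      have : 0 < (2 * Real.pi) ^ d * (K + p.1 • p.2).det := by positivity
      exact (Real.sqrt_pos.2 this).ne'
  · have : Continuous fun N : Matrix (Fin d) (Fin d) ℝ => Real.exp (-(1/2) * (x ⬝ᵥ N *ᵥ x)) := by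
      fun_prop
    exact this.comp_continuousOn h1

lemma contOn_m1 (hd : 1 ≤ d) {K : Matrix (Fin d) (Fin d) ℝ} (hK : K.PosDef) (x : Fin d → ℝ) :
    ContinuousOn (fun p : ℝ × Matrix (Fin d) (Fin d) ℝ => m1 (K + p.1 • p.2) p.2 x)
      (Set.Icc (-1) 1 ×ˢ BB K) := by
  unfold m1
  have h1 := (contOn_inv hd hK).prodMk (continuous_snd.continuousOn)
  have hc : Continuous fun N : Matrix (Fin d) (Fin d) ℝ × Matrix (Fin d) (Fin d) ℝ =>
    1/2 * (x ⬝ᵥ (N.1 * N.2 * N.1) *ᵥ x - (N.1 * N.2).trace) := by fun_prop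
  exact ContinuousOn.congr (hc.comp_continuousOn h1) fun p _ => rfl

lemma contOn_m2 (hd : 1 ≤ d) {K : Matrix (Fin d) (Fin d) ℝ} (hK : K.PosDef) (x : Fin d → ℝ) :
    ContinuousOn (fun p : ℝ × Matrix (Fin d) (Fin d) ℝ => m2 (K + p.1 • p.2) p.2 x)
      (Set.Icc (-1) 1 ×ˢ BB K) := by
  unfold m2
  have h1 := (contOn_inv hd hK).prodMk (continuous_snd.continuousOn)
  have hc : Continuous fun N : Matrix (Fin d) (Fin d) ℝ × Matrix (Fin d) (Fin d) ℝ =>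
    - (x ⬝ᵥ (N.1 * N.2 * N.1 * N.2 * N.1) *ᵥ x) + 1/2 * (N.1 * N.2 * N.1 * N.2).trace := by fun_prop
  exact ContinuousOn.congr (hc.comp_continuousOn h1) fun p _ => rfl

variable {Ω : Type*} [mΩ : MeasurableSpace Ω] {P : Measure Ω} [IsProbabilityMeasure P]
    {K : Matrix (Fin d) (Fin d) ℝ} {A : Ω → Matrix (Fin d) (Fin d) ℝ}

lemma mem_BB (hK : K.PosDef) (hA : ∀ ω, (A ω).PosSemidef) {ω : Ω} (h : ω ∈ EvSet A K) :
    A ω - K ∈ BB K := by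
  refine ⟨?_, h⟩
  rw [Matrix.transpose_sub, isHerm_iff.1 (hA ω).1, isHerm_iff.1 hK.1]

lemma measurable_B (hAmeas : Measurable fun ω i j => A ω i j) :
    Measurable (fun ω i j => (A ω - K) i j) := by
  refine measurable_pi_lambda _ fun i => measurable_pi_lambda _ fun j => ?_
  have h1 : Measurable fun ω => A ω i j :=
    (measurable_pi_apply j).comp ((measurable_pi_apply i).comp hAmeas)
  exact h1.sub_const _

lemma measurableSet_Ev (hd : 1 ≤ d) (hAmeas : Measurable fun ω i j => A ω i j) :
    MeasurableSet (EvSet A K) := by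
  have h : IsClosed {M : Fin d → Fin d → ℝ | opNorm (Matrix.of M) ≤ lambdaMin K / 2} :=
    isClosed_opNorm_le hd _
  exact (measurable_B (K := K) hAmeas) h.measurableSet

lemma integrable_of_contOn (hd : 1 ≤ d) (hK : K.PosDef) (hA : ∀ ω, (A ω).PosSemidef)
    (hAmeas : Measurable fun ω i j => A ω i j) {h : Matrix (Fin d) (Fin d) ℝ → ℝ}
    (hh : ContinuousOn h (BB K)) :
    Integrable (fun ω => h (A ω - K)) (P.restrict (EvSet A K)) := by
  classical
  obtain ⟨C, hC⟩ := (isCompact_BB hd K).exists_bound_of_continuousOn hh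
  have hE := measurableSet_Ev (K := K) hd hAmeas
  have hcl : @IsClosed (Fin d → Fin d → ℝ) _ (BB K) := isClosed_BB hd K
  let T : Set (Fin d → Fin d → ℝ) := BB K
  let h' : (Fin d → Fin d → ℝ) → ℝ := h
  have hh' : ContinuousOn h' T := hh
  have hm : Measurable (Set.piecewise T h' 0) :=
    hh'.measurable_piecewise continuousOn_const hcl.measurableSet
  have hm2 := hm.comp (measurable_B (K := K) hAmeas)
  have hae : AEStronglyMeasurable (fun ω => h (A ω - K)) (P.restrict (EvSet A K)) := by
    refine (hm2.aestronglyMeasurable).congr ?_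
    filter_upwards [ae_restrict_mem hE] with ω hω
    have := mem_BB hK hA hω
    exact Set.piecewise_eq_of_mem T h' 0 this
  refine Integrable.of_bound hae C ?_
  filter_upwards [ae_restrict_mem hE] with ω hω
  exact hC _ (mem_BB hK hA hω)

lemma slice_contOn {h : ℝ × Matrix (Fin d) (Fin d) ℝ → ℝ}
    (hh : ContinuousOn h (Set.Icc (-1) 1 ×ˢ BB K)) {t : ℝ} (ht : t ∈ Set.Icc (-1 : ℝ) 1) :
    ContinuousOn (fun B => h (t, B)) (BB K) :=
  hh.comp (f := fun B => (t, B)) (by fun_prop) fun B hB => ⟨ht, hB⟩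

lemma param_deriv (hd : 1 ≤ d) (hK : K.PosDef) (hA : ∀ ω, (A ω).PosSemidef)
    (hAmeas : Measurable fun ω i j => A ω i j) {f f' : ℝ × Matrix (Fin d) (Fin d) ℝ → ℝ}
    (hf : ContinuousOn f (Set.Icc (-1) 1 ×ˢ BB K)) (hf' : ContinuousOn f' (Set.Icc (-1) 1 ×ˢ BB K))
    (hder : ∀ B ∈ BB K, ∀ t, |t| ≤ 1 → HasDerivAt (fun s => f (s, B)) (f' (t, B)) t)
    {t : ℝ} (ht : |t| < 1) :
    HasDerivAt (fun s => ∫ ω in EvSet A K, f (s, A ω - K) ∂P)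
      (∫ ω in EvSet A K, f' (t, A ω - K) ∂P) t := by
  have hE := measurableSet_Ev (K := K) hd hAmeas
  obtain ⟨C, hC⟩ := (isCompact_Icc.prod (isCompact_BB hd K)).exists_bound_of_continuousOn hf'
  have hs : Set.Icc (-1 : ℝ) 1 ∈ nhds t := Icc_mem_nhds (abs_lt.1 ht).1 (abs_lt.1 ht).2
  refine (hasDerivAt_integral_of_dominated_loc_of_deriv_le (bound := fun _ => C)
    (F := fun s ω => f (s, A ω - K)) (F' := fun s ω => f' (s, A ω - K)) hs ?_ ?_ ?_ ?_ ?_ ?_).2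
  · filter_upwards [hs] with s hs
    exact (integrable_of_contOn hd hK hA hAmeas (slice_contOn hf hs)).aestronglyMeasurable
  · exact integrable_of_contOn hd hK hA hAmeas (slice_contOn hf (mem_of_mem_nhds hs))
  · exact (integrable_of_contOn hd hK hA hAmeas
      (slice_contOn hf' (mem_of_mem_nhds hs))).aestronglyMeasurable
  · filter_upwards [ae_restrict_mem hE] with ω hω s hs
    exact hC _ ⟨hs, mem_BB hK hA hω⟩
  · exact integrable_const _
  · filter_upwards [ae_restrict_mem hE] with ω hω s hs
    exact hder _ (mem_BB hK hA hω) s (abs_le.2 hs)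

lemma Gam_eq (A K : Matrix (Fin d) (Fin d) ℝ) (t : ℝ) : Gam A K t = K + t • (A - K) := by
  unfold Gam
  rw [sub_smul, smul_sub, one_smul]; abel

lemma gtilde_d1 (hd : 1 ≤ d) (hK : K.PosDef) (hA : ∀ ω, (A ω).PosSemidef)
    (hAmeas : Measurable fun ω i j => A ω i j) (x : Fin d → ℝ) {t : ℝ} (ht : |t| < 1) :
    HasDerivAt (fun s => gtilde P A K s x)
      ((∫ ω in EvSet A K, gaussDensity (K + t • (A ω - K)) x * m1 (K + t • (A ω - K)) (A ω - K) x ∂P) /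
      ((P (EvSet A K)).toReal * gaussDensity K x)) t := by
  unfold gtilde
  simp only [Gam_eq]
  exact (param_deriv hd hK hA hAmeas (f := fun p => gaussDensity (K + p.1 • p.2) x)
    (f' := fun p => gaussDensity (K + p.1 • p.2) x * m1 (K + p.1 • p.2) p.2 x)
    (contOn_dens hd hK x) ((contOn_dens hd hK x).mul (contOn_m1 hd hK x))
    (fun B hB t ht => hasDerivAt_dens (det_pos_BB hd hK hB ht) x) ht).div_const _

lemma gtilde_d2 (hd : 1 ≤ d) (hK : K.PosDef) (hA : ∀ ω, (A ω).PosSemidef)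
    (hAmeas : Measurable fun ω i j => A ω i j) (x : Fin d → ℝ) :
    HasDerivAt (fun t : ℝ => (∫ ω in EvSet A K, gaussDensity (K + t • (A ω - K)) x *
        m1 (K + t • (A ω - K)) (A ω - K) x ∂P) /
      ((P (EvSet A K)).toReal * gaussDensity K x))
      ((∫ ω in EvSet A K, gaussDensity (K + (0 : ℝ) • (A ω - K)) x *
        (m1 (K + (0 : ℝ) • (A ω - K)) (A ω - K) x ^ 2 + m2 (K + (0 : ℝ) • (A ω - K)) (A ω - K) x) ∂P) /
      ((P (EvSet A K)).toReal * gaussDensity K x)) 0 := by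
  exact (param_deriv hd hK hA hAmeas
    (f := fun p => gaussDensity (K + p.1 • p.2) x * m1 (K + p.1 • p.2) p.2 x)
    (f' := fun p => gaussDensity (K + p.1 • p.2) x *
      (m1 (K + p.1 • p.2) p.2 x ^ 2 + m2 (K + p.1 • p.2) p.2 x))
    ((contOn_dens hd hK x).mul (contOn_m1 hd hK x))
    ((contOn_dens hd hK x).mul (((contOn_m1 hd hK x).pow 2).add (contOn_m2 hd hK x)))
    (fun B hB t ht => hasDerivAt_dens2 (det_pos_BB hd hK hB ht) x) (t := 0) (by simp)).div_const _

lemma m1_eq (hK : K.PosDef) (B : Matrix (Fin d) (Fin d) ℝ) (x : Fin d → ℝ) :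
    m1 K B x = 1/2 * MvPolynomial.eval (K⁻¹ *ᵥ x) (Qp K⁻¹ B) := by
  have hW : (K⁻¹)ᵀ = K⁻¹ := isHerm_iff.1 hK.inv.1
  have h2 : x ⬝ᵥ (K⁻¹ * B * K⁻¹) *ᵥ x = (K⁻¹ *ᵥ x) ⬝ᵥ B *ᵥ (K⁻¹ *ᵥ x) := by
    simp only [← Matrix.mulVec_mulVec]
    rw [Matrix.dotProduct_mulVec x K⁻¹, ← Matrix.mulVec_transpose, hW]
  rw [eval_Qp, m1, Matrix.trace_mul_comm, h2]

lemma m12_eq (hK : K.PosDef) (B : Matrix (Fin d) (Fin d) ℝ) (x : Fin d → ℝ) :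
    m1 K B x ^ 2 + m2 K B x = MvPolynomial.eval (K⁻¹ *ᵥ x) (Hp K⁻¹ B) := by
  have hW : (K⁻¹)ᵀ = K⁻¹ := isHerm_iff.1 hK.inv.1
  rw [m1_eq hK, eval_Hp, eval_Qp, m2]
  have h1 : (K⁻¹ * B * K⁻¹ * B).trace = (B * K⁻¹ * B * K⁻¹).trace := by
    rw [Matrix.trace_mul_comm]; simp only [Matrix.mul_assoc]
  have h2 : x ⬝ᵥ (K⁻¹ * B * K⁻¹ * B * K⁻¹) *ᵥ x = (K⁻¹ *ᵥ x) ⬝ᵥ (B * K⁻¹ * B) *ᵥ (K⁻¹ *ᵥ x) := by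
    simp only [← Matrix.mulVec_mulVec]
    rw [Matrix.dotProduct_mulVec x K⁻¹, ← Matrix.mulVec_transpose, hW]
  rw [h1, h2]
  ring

lemma iter1 (hd : 1 ≤ d) (hK : K.PosDef) (hA : ∀ ω, (A ω).PosSemidef)
    (hAmeas : Measurable fun ω i j => A ω i j) (x : Fin d → ℝ) :
    iteratedDeriv 1 (fun s => gtilde P A K s x) 0 =
      (P (EvSet A K)).toReal⁻¹ *
        ∫ ω in EvSet A K, 1/2 * MvPolynomial.eval (K⁻¹ *ᵥ x) (Qp K⁻¹ (A ω - K)) ∂P := by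
  have h0 := (gaussDensity_pos hK x).ne'
  rw [iteratedDeriv_one, (gtilde_d1 hd hK hA hAmeas x (t := 0) (by simp)).deriv]
  simp only [zero_smul, add_zero, m1_eq hK]
  rw [integral_const_mul, mul_comm (P (EvSet A K)).toReal, mul_div_mul_left _ _ h0, div_eq_inv_mul]

lemma iter2 (hd : 1 ≤ d) (hK : K.PosDef) (hA : ∀ ω, (A ω).PosSemidef)
    (hAmeas : Measurable fun ω i j => A ω i j) (x : Fin d → ℝ) :
    iteratedDeriv 2 (fun s => gtilde P A K s x) 0 =
      (P (EvSet A K)).toReal⁻¹ *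
        ∫ ω in EvSet A K, MvPolynomial.eval (K⁻¹ *ᵥ x) (Hp K⁻¹ (A ω - K)) ∂P := by
  have h0 := (gaussDensity_pos hK x).ne'
  have he : (iteratedDeriv 1 (fun s => gtilde P A K s x)) =ᶠ[nhds 0] fun t =>
      (∫ ω in EvSet A K, gaussDensity (K + t • (A ω - K)) x *
        m1 (K + t • (A ω - K)) (A ω - K) x ∂P) / ((P (EvSet A K)).toReal * gaussDensity K x) := by
    filter_upwards [Ioo_mem_nhds (show (-1 : ℝ) < 0 by norm_num) (show (0 : ℝ) < 1 by norm_num)] with t ht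
    rw [iteratedDeriv_one, (gtilde_d1 hd hK hA hAmeas x (abs_lt.2 ht)).deriv]
  rw [iteratedDeriv_succ, he.deriv_eq, (gtilde_d2 hd hK hA hAmeas x).deriv]
  simp only [zero_smul, add_zero, m12_eq hK]
  rw [integral_const_mul, mul_comm (P (EvSet A K)).toReal, mul_div_mul_left _ _ h0, div_eq_inv_mul]

end Par


section Avg
variable {d : ℕ}

noncomputable def QpL (W : Matrix (Fin d) (Fin d) ℝ) :
    Matrix (Fin d) (Fin d) ℝ →ₗ[ℝ] MvPolynomial (Fin d) ℝ where
  toFun S := Qp W S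
  map_add' S T := by
    simp only [Qp, Matrix.add_apply, add_smul, Finset.sum_add_distrib, Matrix.add_mul,
      Matrix.trace_add]
    abel
  map_smul' c S := by
    simp only [Qp, Matrix.smul_apply, Matrix.smul_mul, Matrix.trace_smul, smul_sub, Finset.smul_sum,
      smul_smul, smul_eq_mul, RingHom.id_apply]

noncomputable def HpB (W : Matrix (Fin d) (Fin d) ℝ) :
    Matrix (Fin d) (Fin d) ℝ →ₗ[ℝ] Matrix (Fin d) (Fin d) ℝ →ₗ[ℝ] MvPolynomial (Fin d) ℝ :=
  LinearMap.mk₂ ℝ (fun S T => (1/4 : ℝ) • (QpL W S * QpL W T) - QpL W (S * W * T)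
      - ((1/2 : ℝ) * (S * W * T * W).trace) • 1)
    (by intro S T U; simp only [map_add, Matrix.add_mul, add_mul, smul_add, Matrix.trace_add, mul_add, add_smul]; abel)
    (by intro c S T; simp only [map_smul, Matrix.smul_mul, smul_mul_assoc, smul_sub, Matrix.trace_smul, smul_eq_mul, smul_smul, mul_left_comm, mul_comm c (1/4 : ℝ)])
    (by intro S T U; simp only [map_add, Matrix.add_mul, Matrix.mul_add, mul_add, smul_add, Matrix.trace_add, add_smul]; abel)
    (by intro c S T; simp only [map_smul, Matrix.smul_mul, Matrix.mul_smul, mul_smul_comm, smul_sub, Matrix.trace_smul, smul_eq_mul, smul_smul, mul_left_comm, mul_comm c (1/4 : ℝ)])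

lemma HpB_self (W S : Matrix (Fin d) (Fin d) ℝ) : HpB W S S = Hp W S := rfl

lemma mat_expand (S : Matrix (Fin d) (Fin d) ℝ) :
    S = ∑ i, ∑ j, S i j • Matrix.single i j (1 : ℝ) := by
  conv_lhs => rw [Matrix.matrix_eq_sum_single S]
  simp [Matrix.smul_single]

lemma lin_expand (l : Matrix (Fin d) (Fin d) ℝ →ₗ[ℝ] ℝ) (S : Matrix (Fin d) (Fin d) ℝ) :
    l S = ∑ i, ∑ j, S i j * l (Matrix.single i j (1 : ℝ)) := by
  conv_lhs => rw [mat_expand S]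
  simp only [map_sum, map_smul, smul_eq_mul]

lemma bil_expand (b : Matrix (Fin d) (Fin d) ℝ →ₗ[ℝ] Matrix (Fin d) (Fin d) ℝ →ₗ[ℝ] MvPolynomial (Fin d) ℝ)
    (S : Matrix (Fin d) (Fin d) ℝ) :
    b S S = ∑ i, ∑ j, ∑ k, ∑ l, (S i j * S k l) •
      b (Matrix.single k l (1 : ℝ)) (Matrix.single i j (1 : ℝ)) := by
  conv_lhs => rw [mat_expand S]
  simp only [map_sum, LinearMap.sum_apply, map_smul, LinearMap.smul_apply, Finset.smul_sum, smul_smul]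

variable {Ω : Type*} [mΩ : MeasurableSpace Ω] {P : Measure Ω} [IsProbabilityMeasure P]
    {K : Matrix (Fin d) (Fin d) ℝ} {A : Ω → Matrix (Fin d) (Fin d) ℝ}

/-- restricted mean -/
noncomputable def Zm (P : Measure Ω) (A : Ω → Matrix (Fin d) (Fin d) ℝ) (K : Matrix (Fin d) (Fin d) ℝ) :
    Matrix (Fin d) (Fin d) ℝ :=
  Matrix.of fun i j => ∫ ω in EvSet A K, (A ω - K) i j ∂P

lemma integral_lin (hd : 1 ≤ d) (hK : K.PosDef) (hA : ∀ ω, (A ω).PosSemidef)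
    (hAmeas : Measurable fun ω i j => A ω i j) (l : Matrix (Fin d) (Fin d) ℝ →ₗ[ℝ] ℝ) :
    ∫ ω in EvSet A K, l (A ω - K) ∂P = l (Zm P A K) := by
  have hi : ∀ i j, Integrable (fun ω => (A ω - K) i j * l (Matrix.single i j (1 : ℝ)))
      (P.restrict (EvSet A K)) := fun i j =>
    integrable_of_contOn hd hK hA hAmeas (h := fun B => B i j * l (Matrix.single i j (1 : ℝ)))
      (Continuous.continuousOn (by fun_prop))
  rw [lin_expand l (Zm P A K)]
  simp_rw [lin_expand l (A _ - K)]
  rw [integral_finsetSum _ fun i _ => integrable_finsetSum _ fun j _ => hi i j]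
  refine Finset.sum_congr rfl fun i _ => ?_
  rw [integral_finsetSum _ fun j _ => hi i j]
  refine Finset.sum_congr rfl fun j _ => ?_
  rw [integral_mul_const]
  rfl

noncomputable def qZ (P : Measure Ω) (A : Ω → Matrix (Fin d) (Fin d) ℝ) (K : Matrix (Fin d) (Fin d) ℝ) :
    MvPolynomial (Fin d) ℝ :=
  ∑ i, ∑ j, ∑ k, ∑ l, (∫ ω in EvSet A K, (A ω - K) i j * (A ω - K) k l ∂P) •
      HpB K⁻¹ (Matrix.single k l (1 : ℝ)) (Matrix.single i j (1 : ℝ))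

lemma integral_Hp (hd : 1 ≤ d) (hK : K.PosDef) (hA : ∀ ω, (A ω).PosSemidef)
    (hAmeas : Measurable fun ω i j => A ω i j) (Λ : MvPolynomial (Fin d) ℝ →ₗ[ℝ] ℝ) :
    ∫ ω in EvSet A K, Λ (Hp K⁻¹ (A ω - K)) ∂P = Λ (qZ P A K) := by
  have hi : ∀ i j k l, Integrable (fun ω => ((A ω - K) i j * (A ω - K) k l) *
      Λ (HpB K⁻¹ (Matrix.single k l (1 : ℝ)) (Matrix.single i j (1 : ℝ))))
      (P.restrict (EvSet A K)) := fun i j k l =>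
    integrable_of_contOn hd hK hA hAmeas (h := fun B => (B i j * B k l) *
      Λ (HpB K⁻¹ (Matrix.single k l (1 : ℝ)) (Matrix.single i j (1 : ℝ))))
      (Continuous.continuousOn (by fun_prop))
  simp_rw [← HpB_self, bil_expand (HpB K⁻¹) (A _ - K)]
  unfold qZ
  simp only [map_sum, map_smul, smul_eq_mul]
  rw [integral_finsetSum _ fun i _ => integrable_finsetSum _ fun j _ =>
    integrable_finsetSum _ fun k _ => integrable_finsetSum _ fun l _ => hi i j k l]
  refine Finset.sum_congr rfl fun i _ => ?_
  rw [integral_finsetSum _ fun j _ =>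
    integrable_finsetSum _ fun k _ => integrable_finsetSum _ fun l _ => hi i j k l]
  refine Finset.sum_congr rfl fun j _ => ?_
  rw [integral_finsetSum _ fun k _ => integrable_finsetSum _ fun l _ => hi i j k l]
  refine Finset.sum_congr rfl fun k _ => ?_
  rw [integral_finsetSum _ fun l _ => hi i j k l]
  refine Finset.sum_congr rfl fun l _ => ?_
  rw [integral_mul_const]

/-- evaluation as a linear map -/
noncomputable def evL (u : Fin d → ℝ) : MvPolynomial (Fin d) ℝ →ₗ[ℝ] ℝ where
  toFun p := MvPolynomial.eval u p
  map_add' p q := map_add _ p q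
  map_smul' c p := MvPolynomial.smul_eval _ _ _

lemma evL_apply (u : Fin d → ℝ) (p : MvPolynomial (Fin d) ℝ) : evL u p = MvPolynomial.eval u p := rfl

/-- conditional mean -/
noncomputable def Sm (P : Measure Ω) (A : Ω → Matrix (Fin d) (Fin d) ℝ) (K : Matrix (Fin d) (Fin d) ℝ) :
    Matrix (Fin d) (Fin d) ℝ := (P (EvSet A K)).toReal⁻¹ • Zm P A K

lemma iter1' (hd : 1 ≤ d) (hK : K.PosDef) (hA : ∀ ω, (A ω).PosSemidef)
    (hAmeas : Measurable fun ω i j => A ω i j) (x : Fin d → ℝ) :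
    iteratedDeriv 1 (fun s => gtilde P A K s x) 0 =
      1/2 * MvPolynomial.eval (K⁻¹ *ᵥ x) (Qp K⁻¹ (Sm P A K)) := by
  rw [iter1 hd hK hA hAmeas, integral_const_mul]
  have := integral_lin (P := P) hd hK hA hAmeas ((evL (K⁻¹ *ᵥ x)).comp (QpL K⁻¹))
  simp only [LinearMap.comp_apply, evL_apply] at this
  have h2 : (fun ω => MvPolynomial.eval (K⁻¹ *ᵥ x) (Qp K⁻¹ (A ω - K))) = fun ω => MvPolynomial.eval (K⁻¹ *ᵥ x) (QpL K⁻¹ (A ω - K)) := rfl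
  have h3 : Qp K⁻¹ (Sm P A K) = (P (EvSet A K)).toReal⁻¹ • QpL K⁻¹ (Zm P A K) :=
    (QpL K⁻¹).map_smul _ _
  rw [h2, this, h3, MvPolynomial.smul_eval]
  ring

lemma iter2' (hd : 1 ≤ d) (hK : K.PosDef) (hA : ∀ ω, (A ω).PosSemidef)
    (hAmeas : Measurable fun ω i j => A ω i j) (x : Fin d → ℝ) :
    iteratedDeriv 2 (fun s => gtilde P A K s x) 0 =
      (P (EvSet A K)).toReal⁻¹ * MvPolynomial.eval (K⁻¹ *ᵥ x) (qZ P A K) := by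
  rw [iter2 hd hK hA hAmeas]
  have := integral_Hp (P := P) hd hK hA hAmeas (evL (K⁻¹ *ᵥ x))
  simp only [evL_apply] at this
  rw [this]

lemma L_Q_qZ (hd : 1 ≤ d) (hK : K.PosDef) (hA : ∀ ω, (A ω).PosSemidef)
    (hAmeas : Measurable fun ω i j => A ω i j) (L : MvPolynomial (Fin d) ℝ →ₗ[ℝ] ℝ)
    (hL : ∀ i p, L (MvPolynomial.X i * p) = L (Dv K⁻¹ i p)) (h1 : L 1 = 1)
    (T : Matrix (Fin d) (Fin d) ℝ) : L (Qp K⁻¹ T * qZ P A K) = 0 := by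
  have hW : (K⁻¹)ᵀ = K⁻¹ := isHerm_iff.1 hK.inv.1
  have := integral_Hp (P := P) hd hK hA hAmeas (L.comp (LinearMap.mulLeft ℝ (Qp K⁻¹ T)))
  simp only [LinearMap.comp_apply, LinearMap.mulLeft_apply] at this
  rw [← this]
  refine setIntegral_eq_zero_of_forall_eq_zero fun ω hω => ?_
  exact L_QH L hW hL h1 T (mem_BB hK hA hω).1

lemma Sm_symm (hK : K.PosDef) (hA : ∀ ω, (A ω).PosSemidef) : (Sm P A K)ᵀ = Sm P A K := by
  unfold Sm
  rw [Matrix.transpose_smul]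
  congr 1
  ext i j
  simp only [Zm, Matrix.transpose_apply, Matrix.of_apply]
  congr 1
  funext ω
  have h : (A ω - K)ᵀ = A ω - K := by
    rw [Matrix.transpose_sub, isHerm_iff.1 (hA ω).1, isHerm_iff.1 hK.1]
  exact congrFun (congrFun h i) j

lemma Sm_quad (hd : 1 ≤ d) (hK : K.PosDef) (hA : ∀ ω, (A ω).PosSemidef)
    (hAmeas : Measurable fun ω i j => A ω i j) (hPE : 0 < P (EvSet A K)) (x : Fin d → ℝ) :
    |x ⬝ᵥ Sm P A K *ᵥ x| ≤ lambdaMin K / 2 * ∑ i, x i ^ 2 := by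
  have hE := measurableSet_Ev (K := K) hd hAmeas
  have hp : 0 < (P (EvSet A K)).toReal := ENNReal.toReal_pos hPE.ne' (measure_ne_top _ _)
  have h1 := integral_lin (P := P) hd hK hA hAmeas (lq x)
  have h2 : ‖∫ ω in EvSet A K, lq x (A ω - K) ∂P‖ ≤
      (lambdaMin K / 2 * ∑ i, x i ^ 2) * P.real (EvSet A K) := by
    refine norm_setIntegral_le_of_norm_le_const (measure_lt_top _ _) fun ω hω => ?_
    exact quad_le hd hω x
  rw [h1] at h2
  have h3 : x ⬝ᵥ Sm P A K *ᵥ x = (P (EvSet A K)).toReal⁻¹ * lq x (Zm P A K) :=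
    (lq x).map_smul _ _
  rw [h3, abs_mul, abs_of_pos (inv_pos.2 hp), inv_mul_le_iff₀ hp]
  rw [mul_comm]; simpa [Measure.real, mul_comm] using h2

lemma aemeas_G (hK : K.PosDef) {G : Ω → Fin d → ℝ} (hG : Measure.map G P = gaussLaw K) :
    AEMeasurable G P := by
  by_contra h
  rw [Measure.map_of_not_aemeasurable h] at hG
  have h0 : gaussLaw K = 0 := hG.symm
  unfold gaussLaw at h0
  rw [withDensity_eq_zero_iff ((continuous_gaussDensity K).measurable.ennreal_ofReal.aemeasurable)] at h0
  have h1 : ∀ᵐ x : Fin d → ℝ, False := by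
    filter_upwards [h0] with x hx
    have := gaussDensity_pos hK x
    simp at hx
    linarith
  simp only [Filter.eventually_false_iff_eq_bot, ae_eq_bot] at h1
  exact NeZero.ne (volume : Measure (Fin d → ℝ)) h1

lemma LHS_eq (hd : 1 ≤ d) (hK : K.PosDef) (hA : ∀ ω, (A ω).PosSemidef)
    (hAmeas : Measurable fun ω i j => A ω i j) 
    {G : Ω → Fin d → ℝ} (hG : Measure.map G P = gaussLaw K) :
    (1 / 2) * (∫ ω, iteratedDeriv 1 (fun s => gtilde P A K s (G ω)) 0 ^ 2 ∂P)
        - (1 / 6) * (∫ ω, iteratedDeriv 1 (fun s => gtilde P A K s (G ω)) 0 ^ 3 ∂P)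
        + (1 / 2) * ∫ ω, iteratedDeriv 2 (fun s => gtilde P A K s (G ω)) 0 *
            iteratedDeriv 1 (fun s => gtilde P A K s (G ω)) 0 ∂P =
    (1/4) * (Sm P A K * K⁻¹ * Sm P A K * K⁻¹).trace
      - (1/6) * (Sm P A K * K⁻¹ * Sm P A K * K⁻¹ * Sm P A K * K⁻¹).trace := by
  have hGm := aemeas_G hK hG
  have hW : (K⁻¹)ᵀ = K⁻¹ := isHerm_iff.1 hK.inv.1
  have hS := Sm_symm (P := P) hK hA
  have hmap : ∀ p : MvPolynomial (Fin d) ℝ, ∫ ω, MvPolynomial.eval (K⁻¹ *ᵥ G ω) p ∂P = LK hd hK p := by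
    intro p
    have := integral_map hGm (f := fun x => MvPolynomial.eval (K⁻¹ *ᵥ x) p)
      (continuous_eval_mulVec _ p).aestronglyMeasurable
    rw [hG] at this
    exact this.symm
  have h1 : LK hd hK 1 = 1 := by rw [← hmap]; simp
  have hL : ∀ i p, LK hd hK (MvPolynomial.X i * p) = LK hd hK (Dv K⁻¹ i p) := fun i p => stein hd hK i p
  simp only [iter1' hd hK hA hAmeas, iter2' hd hK hA hAmeas]
  set Q := Qp K⁻¹ (Sm P A K) with hQ
  have e2 : ∫ ω, (1/2 * MvPolynomial.eval (K⁻¹ *ᵥ G ω) Q) ^ 2 ∂P = 1/4 * LK hd hK (Q * Q) := by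
    rw [← hmap, ← integral_const_mul]
    congr 1; funext ω; rw [map_mul]; ring
  have e3 : ∫ ω, (1/2 * MvPolynomial.eval (K⁻¹ *ᵥ G ω) Q) ^ 3 ∂P = 1/8 * LK hd hK (Q * (Q * Q)) := by
    rw [← hmap, ← integral_const_mul]
    congr 1; funext ω; rw [map_mul, map_mul]; ring
  have e4 : ∫ ω, ((P (EvSet A K)).toReal⁻¹ * MvPolynomial.eval (K⁻¹ *ᵥ G ω) (qZ P A K)) *
      (1/2 * MvPolynomial.eval (K⁻¹ *ᵥ G ω) Q) ∂P =
      ((P (EvSet A K)).toReal⁻¹ * (1/2)) * LK hd hK (Q * qZ P A K) := by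
    rw [← hmap, ← integral_const_mul]
    congr 1; funext ω; rw [map_mul]; ring
  rw [e2, e3, e4, L_Q_qZ hd hK hA hAmeas _ hL h1, L_QQ _ hW hL h1 _ hS, L_QQQ _ hW hL h1 _ hS]
  ring

end Avg


section Fin
variable {d : ℕ}

lemma c0_ge (d : ℕ) : 1 ≤ (Real.sqrt 3 / (12 * Real.sqrt 2)) * Cfac d := by
  have h6 : Real.sqrt 6 = Real.sqrt 2 * Real.sqrt 3 := by
    rw [← Real.sqrt_mul (by norm_num)]; norm_num
  have h2 : Real.sqrt 2 ^ 2 = 2 := Real.sq_sqrt (by norm_num)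
  have h3 : Real.sqrt 3 ^ 2 = 3 := Real.sq_sqrt (by norm_num)
  have a2 : 1.41 ≤ Real.sqrt 2 := Real.le_sqrt_of_sq_le (by norm_num)
  have b2 : Real.sqrt 2 ≤ 1.415 := Real.sqrt_le_iff.2 ⟨by norm_num, by norm_num⟩
  have a3 : 1.73 ≤ Real.sqrt 3 := Real.le_sqrt_of_sq_le (by norm_num)
  have hd := Real.sqrt_nonneg (d : ℝ)
  rw [div_mul_eq_mul_div, one_le_div (by positivity), Cfac, h6]
  have h1 : 1.41 * 1.73 ≤ Real.sqrt 2 * Real.sqrt 3 := mul_le_mul a2 a3 (by norm_num) (by positivity)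
  have h4 : 0 ≤ Real.sqrt 3 * Real.sqrt d := by positivity
  have h5 : Real.sqrt 3 * (2 * (Real.sqrt 2 * Real.sqrt 3) + 3 * Real.sqrt 2 + 2 + Real.sqrt d) =
    2 * Real.sqrt 2 * Real.sqrt 3 ^ 2 + 3 * (Real.sqrt 2 * Real.sqrt 3) + 2 * Real.sqrt 3
      + Real.sqrt 3 * Real.sqrt d := by ring
  rw [h5, h3]
  linarith

lemma cs_int {Ω : Type*} [MeasurableSpace Ω] (μ : Measure Ω) [IsFiniteMeasure μ] {f : Ω → ℝ}
    (hf : Integrable f μ) (hf2 : Integrable (fun ω => f ω ^ 2) μ) :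
    (∫ ω, f ω ∂μ) ^ 2 ≤ μ.real Set.univ * ∫ ω, f ω ^ 2 ∂μ := by
  set q := μ.real Set.univ with hq
  set I := ∫ ω, f ω ∂μ with hI
  have hq0 : 0 ≤ q := measureReal_nonneg
  rcases hq0.eq_or_lt with h | h
  · have : μ = 0 := by
      have h' : μ.real Set.univ = 0 := by rw [← hq, ← h]
      rw [measureReal_eq_zero_iff] at h'
      exact Measure.measure_univ_eq_zero.1 h'
    rw [hI, this]; simp
  · have h1 : 0 ≤ ∫ ω, (q * f ω - I) ^ 2 ∂μ := integral_nonneg fun ω => sq_nonneg _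
    have h2 : ∫ ω, (q * f ω - I) ^ 2 ∂μ = q ^ 2 * (∫ ω, f ω ^ 2 ∂μ) - 2 * q * I * I + q * I ^ 2 := by
      have : ∀ ω, (q * f ω - I) ^ 2 = (q ^ 2 * f ω ^ 2 - (2 * q * I) * f ω) + I ^ 2 := fun ω => by ring
      simp_rw [this]
      have hab : Integrable (fun ω => q ^ 2 * f ω ^ 2 - (2 * q * I) * f ω) μ :=
        (hf2.const_mul _).sub (hf.const_mul _)
      rw [integral_add hab (integrable_const _),
        integral_sub (hf2.const_mul _) (hf.const_mul _), integral_const_mul, integral_const_mul,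
        integral_const, smul_eq_mul]
    rw [h2] at h1
    have h3 : 0 ≤ q * (q * (∫ ω, f ω ^ 2 ∂μ) - I ^ 2) := by nlinarith
    have := nonneg_of_mul_nonneg_right h3 h
    linarith

variable {Ω : Type*} [mΩ : MeasurableSpace Ω] {P : Measure Ω} [IsProbabilityMeasure P]
    {K : Matrix (Fin d) (Fin d) ℝ} {A : Ω → Matrix (Fin d) (Fin d) ℝ}

lemma meas_entry (hAmeas : Measurable fun ω i j => A ω i j) (i j : Fin d) :
    Measurable fun ω => (A ω - K) i j :=
  (measurable_pi_apply j).comp ((measurable_pi_apply i).comp (measurable_B (K := K) hAmeas))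

lemma meas_hs2 (hAmeas : Measurable fun ω i j => A ω i j) :
    Measurable fun ω => hsNorm (A ω - K) ^ 2 := by
  simp_rw [hsNorm_sq]
  exact Finset.measurable_fun_sum _ fun i _ => Finset.measurable_fun_sum _ fun j _ =>
    (meas_entry hAmeas i j).pow_const 2

lemma hs_sub_le (A K : Matrix (Fin d) (Fin d) ℝ) :
    hsNorm (A - K) ^ 2 ≤ 2 * hsNorm A ^ 2 + 2 * hsNorm K ^ 2 := by
  simp_rw [hsNorm_sq, Finset.mul_sum, ← Finset.sum_add_distrib]
  refine Finset.sum_le_sum fun i _ => Finset.sum_le_sum fun j _ => ?_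
  rw [Matrix.sub_apply]
  nlinarith [sq_nonneg (A i j + K i j)]

lemma int_hs4 (hAmeas : Measurable fun ω i j => A ω i j)
    (hA8 : Integrable (fun ω => hsNorm (A ω) ^ 8) P) :
    Integrable (fun ω => hsNorm (A ω - K) ^ 4) P := by
  have h := ((hA8.const_mul 8).add (integrable_const (8 + 8 * hsNorm K ^ 4)))
  refine h.mono' ?_ (Filter.Eventually.of_forall fun ω => ?_)
  · have : (fun ω => hsNorm (A ω - K) ^ 4) = fun ω => (hsNorm (A ω - K) ^ 2) ^ 2 := by
      funext ω; ring
    rw [this]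
    exact ((meas_hs2 hAmeas).pow_const 2).aestronglyMeasurable
  · have h1 := hs_sub_le (A ω) K
    have h2 : 0 ≤ hsNorm (A ω - K) ^ 2 := sq_nonneg _
    have h3 : hsNorm (A ω - K) ^ 4 = (hsNorm (A ω - K) ^ 2) ^ 2 := by ring
    have h4 : hsNorm (A ω) ^ 8 = ((hsNorm (A ω) ^ 2) ^ 2) ^ 2 := by ring
    have h5 : hsNorm K ^ 4 = (hsNorm K ^ 2) ^ 2 := by ring
    rw [Real.norm_of_nonneg (by positivity)]
    simp only [Pi.add_apply]
    rw [h3, h4, h5]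
    set a := hsNorm (A ω) ^ 2
    set k := hsNorm K ^ 2
    set n := hsNorm (A ω - K) ^ 2
    have h6 : n ^ 2 ≤ (2 * a + 2 * k) ^ 2 := pow_le_pow_left₀ h2 h1 2
    nlinarith [sq_nonneg (a - k), sq_nonneg (a ^ 2 - 1)]

lemma int_hs2 (hAmeas : Measurable fun ω i j => A ω i j)
    (hA8 : Integrable (fun ω => hsNorm (A ω) ^ 8) P) :
    Integrable (fun ω => hsNorm (A ω - K) ^ 2) P := by
  have h := (int_hs4 (K := K) hAmeas hA8).add (integrable_const (1:ℝ))
  refine h.mono' (meas_hs2 hAmeas).aestronglyMeasurable (Filter.Eventually.of_forall fun ω => ?_)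
  rw [Real.norm_of_nonneg (by positivity)]
  simp only [Pi.add_apply]
  nlinarith [sq_nonneg (hsNorm (A ω - K) ^ 2 - 1)]

lemma entry_sq_le (B : Matrix (Fin d) (Fin d) ℝ) (i j : Fin d) : B i j ^ 2 ≤ hsNorm B ^ 2 := by
  rw [hsNorm_sq]
  refine le_trans ?_ (Finset.single_le_sum (f := fun i => ∑ j, B i j ^ 2)
    (fun i _ => Finset.sum_nonneg fun j _ => sq_nonneg _) (Finset.mem_univ i))
  exact Finset.single_le_sum (f := fun j => B i j ^ 2) (fun j _ => sq_nonneg _) (Finset.mem_univ j)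

lemma int_entry2 (hAmeas : Measurable fun ω i j => A ω i j)
    (hA8 : Integrable (fun ω => hsNorm (A ω) ^ 8) P) (i j : Fin d) :
    Integrable (fun ω => (A ω - K) i j ^ 2) P := by
  refine (int_hs2 (K := K) hAmeas hA8).mono' ((meas_entry hAmeas i j).pow_const 2).aestronglyMeasurable
    (Filter.Eventually.of_forall fun ω => ?_)
  rw [Real.norm_of_nonneg (by positivity)]
  exact entry_sq_le _ i j

lemma int_entry (hAmeas : Measurable fun ω i j => A ω i j)
    (hA8 : Integrable (fun ω => hsNorm (A ω) ^ 8) P) (i j : Fin d) :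
    Integrable (fun ω => (A ω - K) i j) P := by
  refine ((int_entry2 (K := K) hAmeas hA8 i j).add (integrable_const (1:ℝ))).mono'
    (meas_entry hAmeas i j).aestronglyMeasurable
    (Filter.Eventually.of_forall fun ω => ?_)
  simp only [Pi.add_apply, Real.norm_eq_abs]
  have := sq_abs ((A ω - K) i j)
  nlinarith [sq_nonneg (|(A ω - K) i j| - 1), sq_nonneg (|(A ω - K) i j|)]

lemma compl_bound (hd : 1 ≤ d) (hK : K.PosDef) {ω : Ω} (h : ω ∈ (EvSet A K)ᶜ) :
    lambdaMin K ^ 2 / 4 ≤ hsNorm (A ω - K) ^ 2 := by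
  have h1 : lambdaMin K / 2 < opNorm (A ω - K) := not_le.1 h
  have h2 := opNorm_le_hsNorm hd (A ω - K)
  have h3 := lambdaMin_pos hd hK
  nlinarith

lemma cheb2 (hd : 1 ≤ d) (hK : K.PosDef) (hAmeas : Measurable fun ω i j => A ω i j)
    (hA8 : Integrable (fun ω => hsNorm (A ω) ^ 8) P) :
    lambdaMin K ^ 2 / 4 * P.real (EvSet A K)ᶜ ≤ ∫ ω, hsNorm (A ω - K) ^ 2 ∂P := by
  refine le_trans ?_ (mul_meas_ge_le_integral_of_nonneg
    (Filter.Eventually.of_forall fun ω => by positivity) (int_hs2 hAmeas hA8) (lambdaMin K ^ 2 / 4))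
  refine mul_le_mul_of_nonneg_left (measureReal_mono fun ω hω => compl_bound hd hK hω) (by positivity)

lemma cheb4 (hd : 1 ≤ d) (hK : K.PosDef) (hAmeas : Measurable fun ω i j => A ω i j)
    (hA8 : Integrable (fun ω => hsNorm (A ω) ^ 8) P) :
    lambdaMin K ^ 4 / 16 * P.real (EvSet A K)ᶜ ≤ ∫ ω, hsNorm (A ω - K) ^ 4 ∂P := by
  refine le_trans ?_ (mul_meas_ge_le_integral_of_nonneg
    (Filter.Eventually.of_forall fun ω => by positivity) (int_hs4 hAmeas hA8) (lambdaMin K ^ 4 / 16))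
  refine mul_le_mul_of_nonneg_left (measureReal_mono fun ω hω => ?_) (by positivity)
  have h1 := compl_bound hd hK hω
  have h2 := pow_le_pow_left₀ (by positivity) h1 2
  change lambdaMin K ^ 4 / 16 ≤ hsNorm (A ω - K) ^ 4
  calc lambdaMin K ^ 4 / 16 = (lambdaMin K ^ 2 / 4) ^ 2 := by ring
    _ ≤ _ := h2
    _ = _ := by ring

lemma Zm_bound (hd : 1 ≤ d) (hAmeas : Measurable fun ω i j => A ω i j)
    (hA8 : Integrable (fun ω => hsNorm (A ω) ^ 8) P) :
    hsNorm (Zm P A K) ^ 2 ≤ 2 * hsNorm ((Matrix.of fun i j => ∫ ω, A ω i j ∂P) - K) ^ 2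
      + 2 * (P.real (EvSet A K)ᶜ * ∫ ω, hsNorm (A ω - K) ^ 2 ∂P) := by
  have hE := measurableSet_Ev (K := K) hd hAmeas
  set q := P.real (EvSet A K)ᶜ with hq
  have hq0 : 0 ≤ q := measureReal_nonneg
  have hs : ∫ ω, hsNorm (A ω - K) ^ 2 ∂P = ∑ i, ∑ j, ∫ ω, (A ω - K) i j ^ 2 ∂P := by
    simp_rw [hsNorm_sq]
    rw [integral_finsetSum _ fun i _ => integrable_finsetSum _ fun j _ => int_entry2 hAmeas hA8 i j]
    refine Finset.sum_congr rfl fun i _ => ?_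
    rw [integral_finsetSum _ fun j _ => int_entry2 hAmeas hA8 i j]
  rw [hs]
  simp only [hsNorm_sq, Finset.mul_sum, ← Finset.sum_add_distrib]
  refine Finset.sum_le_sum fun i _ => Finset.sum_le_sum fun j _ => ?_
  have hi := int_entry (K := K) hAmeas hA8 i j
  have hi2 := int_entry2 (K := K) hAmeas hA8 i j
  have h1 := integral_add_compl hE hi
  have h2 : ∫ ω, (A ω - K) i j ∂P = ((Matrix.of fun i j => ∫ ω, A ω i j ∂P) - K) i j := by
    have hAi : Integrable (fun ω => A ω i j) P := by
      have := hi.add (integrable_const (K i j))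
      refine this.congr (Filter.Eventually.of_forall fun ω => ?_)
      simp
    simp only [Matrix.sub_apply, Matrix.of_apply]
    rw [integral_sub hAi (integrable_const _)]
    simp
  have h3 := cs_int (P.restrict (EvSet A K)ᶜ) hi.integrableOn hi2.integrableOn
  have h4 : (P.restrict (EvSet A K)ᶜ).real Set.univ = q := by simp [hq]
  have h5 : ∫ ω in (EvSet A K)ᶜ, (A ω - K) i j ^ 2 ∂P ≤ ∫ ω, (A ω - K) i j ^ 2 ∂P :=
    setIntegral_le_integral hi2 (Filter.Eventually.of_forall fun ω => sq_nonneg _)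
  rw [h4] at h3
  have h6 := h3.trans (mul_le_mul_of_nonneg_left h5 hq0)
  have h7 : Zm P A K i j = ∫ ω in EvSet A K, (A ω - K) i j ∂P := rfl
  rw [h7, ← h2]
  set a := ∫ ω in EvSet A K, (A ω - K) i j ∂P
  set b := ∫ ω in (EvSet A K)ᶜ, (A ω - K) i j ∂P
  set e := ∫ ω, (A ω - K) i j ∂P
  have h8 : a = e - b := by linarith
  rw [h8]
  nlinarith [sq_nonneg (e + b)]

lemma real_ineq {p q τ2 τ3 w k z e m2 m4 l c0 D last : ℝ} (hp : 0 < p) (t3 : 0 ≤ τ3 + 1/2 * τ2)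
    (t2d : τ2 ≤ D / 4) (t2 : τ2 ≤ w * (p⁻¹ ^ 2 * z)) (hdd : D ^ 2 ≤ w * k) (hc0 : 1 ≤ c0)
    (hZ : z ≤ 2 * e + 2 * (q * m2)) (c2 : l ^ 2 / 4 * q ≤ m2) (c4 : l ^ 4 / 16 * q ≤ m4)
    (hl : 0 < l) (hqp : q = 1 - p) (hm2 : 0 ≤ m2) (hm4 : 0 ≤ m4)
    (he0 : 0 ≤ e) (hz0 : 0 ≤ z) (hw0 : 0 ≤ w) (hk0 : 0 ≤ k) (hlast : 0 ≤ last) (hd1 : 1 ≤ D) :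
    p * (1/4 * τ2 - 1/6 * τ3) ≤
      c0 * w * (e + 8 / l ^ 2 * m2 ^ 2 + 32 / l ^ 4 * k * m4) + last := by
  have hin : 0 ≤ e + 8 / l ^ 2 * m2 ^ 2 + 32 / l ^ 4 * k * m4 := by positivity
  have hR : w * (e + 8 / l ^ 2 * m2 ^ 2 + 32 / l ^ 4 * k * m4) ≤
      c0 * w * (e + 8 / l ^ 2 * m2 ^ 2 + 32 / l ^ 4 * k * m4) :=
    mul_le_mul_of_nonneg_right (le_mul_of_one_le_left hw0 hc0) hin
  have hLHS : p * (1/4 * τ2 - 1/6 * τ3) ≤ p * (τ2 / 3) :=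
    mul_le_mul_of_nonneg_left (by linarith) hp.le
  refine hLHS.trans (le_trans ?_ (hR.trans (le_add_of_nonneg_right hlast)))
  have p1 : 0 ≤ 8 / l ^ 2 * m2 ^ 2 := by positivity
  have p2 : 0 ≤ 32 / l ^ 4 * k * m4 := by positivity
  by_cases hcase : 2 / 3 ≤ p
  · have h1 : p * (τ2 / 3) ≤ w * z / 2 := by
      calc p * (τ2 / 3) ≤ p * ((w * (p⁻¹ ^ 2 * z)) / 3) := by gcongr
        _ = w * z * (p⁻¹ / 3) := by field_simp
        _ ≤ w * z * (1 / 2) := by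
          refine mul_le_mul_of_nonneg_left ?_ (mul_nonneg hw0 hz0)
          have : p⁻¹ ≤ (2/3 : ℝ)⁻¹ := inv_anti₀ (by norm_num) hcase
          norm_num at this
          linarith
        _ = _ := by ring
    have h2 : q * m2 ≤ 4 / l ^ 2 * m2 ^ 2 := by
      have : q ≤ 4 / l ^ 2 * m2 := by
        rw [div_mul_eq_mul_div, le_div_iff₀ (by positivity)]
        linarith
      calc q * m2 ≤ (4 / l ^ 2 * m2) * m2 := mul_le_mul_of_nonneg_right this hm2
        _ = _ := by ring
    have h3 : 4 / l ^ 2 * m2 ^ 2 ≤ 8 / l ^ 2 * m2 ^ 2 := by gcongr; norm_num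
    refine h1.trans ?_
    have : w * z ≤ w * (2 * (e + 8 / l ^ 2 * m2 ^ 2 + 32 / l ^ 4 * k * m4)) :=
      mul_le_mul_of_nonneg_left (by linarith) hw0
    linarith
  · push Not at hcase
    have h1 : l ^ 4 / 48 ≤ m4 := by
      have : l ^ 4 / 16 * (1 / 3) ≤ l ^ 4 / 16 * q :=
        mul_le_mul_of_nonneg_left (by rw [hqp]; linarith) (by positivity)
      linarith
    have h2 : 2 / 3 * k ≤ 32 / l ^ 4 * k * m4 := by
      calc 2 / 3 * k = 32 / l ^ 4 * k * (l ^ 4 / 48) := by field_simp; ring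
        _ ≤ _ := by gcongr
    have h3 : p * (τ2 / 3) ≤ D / 12 := by
      have a : p * (τ2 / 3) ≤ p * ((D / 4) / 3) := by gcongr
      have b : p * ((D / 4 : ℝ) / 3) ≤ 1 * ((D / 4) / 3) := mul_le_mul_of_nonneg_right (by linarith) (by positivity)
      linarith
    have h4 : w * (2 / 3 * k) ≤ w * (e + 8 / l ^ 2 * m2 ^ 2 + 32 / l ^ 4 * k * m4) :=
      mul_le_mul_of_nonneg_left (by linarith) hw0
    nlinarith

lemma final_ineq (hd : 1 ≤ d) (hK : K.PosDef) (hA : ∀ ω, (A ω).PosSemidef)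
    (hAmeas : Measurable fun ω i j => A ω i j)
    (hA8 : Integrable (fun ω => hsNorm (A ω) ^ 8) P) (hPE : 0 < P (EvSet A K)) :
    (P (EvSet A K)).toReal * ((1/4) * (Sm P A K * K⁻¹ * Sm P A K * K⁻¹).trace
      - (1/6) * (Sm P A K * K⁻¹ * Sm P A K * K⁻¹ * Sm P A K * K⁻¹).trace) ≤
      (Real.sqrt 3 / (12 * Real.sqrt 2)) * Cfac d * hsNorm K⁻¹ ^ 2 *
        (hsNorm ((Matrix.of fun i j => ∫ ω, A ω i j ∂P) - K) ^ 2
          + (8 / lambdaMin K ^ 2) * (∫ ω, hsNorm (A ω - K) ^ 2 ∂P) ^ 2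
          + (32 / lambdaMin K ^ 4) * hsNorm K ^ 2 * ∫ ω, hsNorm (A ω - K) ^ 4 ∂P)
      + (Real.sqrt 3 / 8) * hsNorm K⁻¹ ^ 4 * ∫ ω, hsNorm (A ω - K) ^ 4 ∂P := by
  have hE := measurableSet_Ev (K := K) hd hAmeas
  have hp : 0 < (P (EvSet A K)).toReal := ENNReal.toReal_pos hPE.ne' (measure_ne_top _ _)
  obtain ⟨t3, t2d, t2, hdd⟩ := trace_bounds hK (Sm_symm (P := P) hK hA)
    (Sm_quad hd hK hA hAmeas hPE)
  have hc0 := c0_ge d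
  have hZ := Zm_bound (K := K) hd hAmeas hA8
  have c2 := cheb2 hd hK hAmeas hA8
  have c4 := cheb4 hd hK hAmeas hA8
  have hl := lambdaMin_pos hd hK
  have hqp : P.real (EvSet A K)ᶜ = 1 - (P (EvSet A K)).toReal := by
    rw [probReal_compl_eq_one_sub hE]; rfl
  have hS : hsNorm (Sm P A K) ^ 2 = (P (EvSet A K)).toReal⁻¹ ^ 2 * hsNorm (Zm P A K) ^ 2 := by
    simp only [hsNorm_sq, Sm, Matrix.smul_apply, smul_eq_mul, mul_pow, Finset.mul_sum]
  have hm2 : 0 ≤ ∫ ω, hsNorm (A ω - K) ^ 2 ∂P := integral_nonneg fun ω => by positivity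
  have hm4 : 0 ≤ ∫ ω, hsNorm (A ω - K) ^ 4 ∂P := integral_nonneg fun ω => by positivity
  have he0 : 0 ≤ hsNorm ((Matrix.of fun i j => ∫ ω, A ω i j ∂P) - K) ^ 2 := sq_nonneg _
  have hz0 : 0 ≤ hsNorm (Zm P A K) ^ 2 := sq_nonneg _
  have hw0 : 0 ≤ hsNorm K⁻¹ ^ 2 := sq_nonneg _
  have hk0 : 0 ≤ hsNorm K ^ 2 := sq_nonneg _
  have hlast : 0 ≤ (Real.sqrt 3 / 8) * hsNorm K⁻¹ ^ 4 * ∫ ω, hsNorm (A ω - K) ^ 4 ∂P :=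
    mul_nonneg (mul_nonneg (div_nonneg (Real.sqrt_nonneg _) (by norm_num)) (pow_nonneg (hsNorm_nonneg _) 4)) hm4
  rw [hS] at t2
  have hd1 : (1 : ℝ) ≤ d := by exact_mod_cast hd
  exact real_ineq hp t3 t2d t2 hdd hc0 hZ c2 c4 hl hqp hm2 hm4 he0 hz0 hw0 hk0 hlast hd1

end Fin

/-- Lemma `term_con_zero`: bound for the zero-order Taylor terms. -/
theorem statement_15
    {d : ℕ} (hd : 1 ≤ d)
    {Ω : Type*} [mΩ : MeasurableSpace Ω] (P : Measure Ω) [IsProbabilityMeasure P]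
    (K : Matrix (Fin d) (Fin d) ℝ) (hK : K.PosDef)
    (A : Ω → Matrix (Fin d) (Fin d) ℝ) (hA : ∀ ω, (A ω).PosSemidef)
    (hAmeas : Measurable fun ω i j => A ω i j)
    (hA8 : Integrable (fun ω => hsNorm (A ω) ^ 8) P)
    (G : Ω → Fin d → ℝ) (hG : Measure.map G P = gaussLaw K)
    (hInd : IndepFun G (fun ω i j => A ω i j) P)
    (hPE : 0 < P (EvSet A K)) :
    (P (EvSet A K)).toReal *
      ((1 / 2) * (∫ ω, iteratedDeriv 1 (fun s => gtilde P A K s (G ω)) 0 ^ 2 ∂P)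
        - (1 / 6) * (∫ ω, iteratedDeriv 1 (fun s => gtilde P A K s (G ω)) 0 ^ 3 ∂P)
        + (1 / 2) * ∫ ω, iteratedDeriv 2 (fun s => gtilde P A K s (G ω)) 0 *
            iteratedDeriv 1 (fun s => gtilde P A K s (G ω)) 0 ∂P) ≤
      (Real.sqrt 3 / (12 * Real.sqrt 2)) * Cfac d * hsNorm K⁻¹ ^ 2 *
        (hsNorm ((Matrix.of fun i j => ∫ ω, A ω i j ∂P) - K) ^ 2
          + (8 / lambdaMin K ^ 2) * (∫ ω, hsNorm (A ω - K) ^ 2 ∂P) ^ 2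
          + (32 / lambdaMin K ^ 4) * hsNorm K ^ 2 * ∫ ω, hsNorm (A ω - K) ^ 4 ∂P)
      + (Real.sqrt 3 / 8) * hsNorm K⁻¹ ^ 4 * ∫ ω, hsNorm (A ω - K) ^ 4 ∂P := by
  rw [LHS_eq hd hK hA hAmeas hG]
  exact final_ineq hd hK hA hAmeas hA8 hPE
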